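/- arXiv:2508.19064 — 2 statements merged into one kernel-verified Lean document; each statement's English description precedes it below -/
import Mathlib

section
/- For every Schwartz function ψ : ℝ×ℝ² → ℂ with ψ(−ω,σ) = ψ(ω,σ) for all (ω,σ), there exists a Schwartz function g : ℝ×ℝ² → ℂ such that g(ω,σ) = ω · ψ(√(ω² − ‖σ‖²), σ) for every (ω,σ) ∈ ℝ×ℝ² with |ω| ≥ ‖σ‖. -/
open Real


section Aux10Section

open SchwartzMap MeasureTheory
open scoped ContDiff SchwartzMap

namespace Aux10

variable {X : Type} [NormedAddCommGroup X] [NormedSpace ℝ X]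

theorem nle (j : ℕ) : (j : WithTop ℕ∞) ≤ ∞ := by exact_mod_cast le_top

theorem slice_bound {F : Type} [NormedAddCommGroup F] [NormedSpace ℝ F]
    (H : 𝓢(ℝ × X, F)) (m l : ℕ) :
    ∃ C : ℝ, ∀ (τ : ℝ) (x : X), ‖x‖ ^ m * ‖H (τ, x)‖ ≤ C * (1 + ‖τ‖) ^ (-(l : ℝ)) := by
  obtain ⟨C1, -, h1⟩ := H.decay m 0
  obtain ⟨C2, -, h2⟩ := H.decay (l + m) 0
  simp only [norm_iteratedFDeriv_zero] at h1 h2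
  refine ⟨2 ^ l * (C1 + C2), fun τ x => ?_⟩
  have hx : ‖x‖ ≤ ‖(τ, x)‖ := le_max_right _ _
  have ht : ‖τ‖ ≤ ‖(τ, x)‖ := le_max_left _ _
  have := pow_mul_le_of_le_of_pow_mul_le (C₁ := C1) (C₂ := C2) (k := 0) (l := l) (x := ‖τ‖)
    (f := ‖x‖ ^ m * ‖H (τ, x)‖) (norm_nonneg _) (by positivity) ?_ ?_
  · simpa using this
  · refine le_trans ?_ (h1 (τ, x))
    gcongr
  · refine le_trans ?_ (h2 (τ, x))
    rw [zero_add, ← mul_assoc, pow_add]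
    gcongr

theorem slice_integrable {F : Type} [NormedAddCommGroup F] [NormedSpace ℝ F]
    (μ : Measure ℝ) [μ.HasTemperateGrowth]
    (H : 𝓢(ℝ × X, F)) (x : X) : Integrable (fun τ => H (τ, x)) μ := by
  obtain ⟨C, hC⟩ := slice_bound H 0 μ.integrablePower
  refine (μ.integrable_pow_neg_integrablePower.const_mul C).mono' ?_ ?_
  · exact (H.continuous.comp (by fun_prop)).aestronglyMeasurable
  · filter_upwards with τ
    simpa using hC τ x

/-- Derivative of a Schwartz function in the second variable. -/
noncomputable def dsnd {F : Type} [NormedAddCommGroup F] [NormedSpace ℝ F]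
    (H : 𝓢(ℝ × X, F)) : 𝓢(ℝ × X, X →L[ℝ] F) :=
  postcompCLM ((ContinuousLinearMap.compL ℝ X (ℝ × X) F).flip (ContinuousLinearMap.inr ℝ ℝ X))
    (fderivCLM ℝ (ℝ × X) F H)

theorem dsnd_apply {F : Type} [NormedAddCommGroup F] [NormedSpace ℝ F]
    (H : 𝓢(ℝ × X, F)) (p : ℝ × X) :
    dsnd H p = (fderiv ℝ H p).comp (ContinuousLinearMap.inr ℝ ℝ X) := rfl

theorem hasFDerivAt_int {F : Type} [NormedAddCommGroup F] [NormedSpace ℝ F]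
    (μ : Measure ℝ) [μ.HasTemperateGrowth] (H : 𝓢(ℝ × X, F)) (x : X) :
    HasFDerivAt (fun x => ∫ τ, H (τ, x) ∂μ) (∫ τ, dsnd H (τ, x) ∂μ) x := by
  obtain ⟨C, hC⟩ := slice_bound (dsnd H) 0 μ.integrablePower
  refine hasFDerivAt_integral_of_dominated_of_fderiv_le (𝕜 := ℝ) (s := Set.univ)
    (F := fun y τ => H (τ, y)) (F' := fun y τ => dsnd H (τ, y)) Filter.univ_mem
    (bound := fun τ : ℝ => C * (1 + ‖τ‖) ^ (-(μ.integrablePower : ℝ))) ?_ ?_ ?_ ?_ ?_ ?_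
  · filter_upwards with y
    exact (slice_integrable μ H y).aestronglyMeasurable
  · exact slice_integrable μ H x
  · exact (slice_integrable μ (dsnd H) x).aestronglyMeasurable
  · filter_upwards with τ y _
    simpa using hC τ y
  · exact μ.integrable_pow_neg_integrablePower.const_mul C
  · filter_upwards with τ y _
    have h1 := (H.hasFDerivAt (τ, y))
    have h2 : HasFDerivAt (fun y : X => (τ, y)) (ContinuousLinearMap.inr ℝ ℝ X) y :=
      hasFDerivAt_prodMk_right τ y
    exact h1.comp y h2

theorem int_aux (μ : Measure ℝ) [μ.HasTemperateGrowth] (n : ℕ) :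
    ∀ {F : Type} [NormedAddCommGroup F] [NormedSpace ℝ F] (H : 𝓢(ℝ × X, F)),
    ContDiff ℝ n (fun x => ∫ τ, H (τ, x) ∂μ) ∧
    ∀ m : ℕ, ∃ C : ℝ, ∀ x, ‖x‖ ^ m * ‖iteratedFDeriv ℝ n (fun x => ∫ τ, H (τ, x) ∂μ) x‖ ≤ C := by
  induction n with
  | zero =>
    intro F _ _ H
    refine ⟨?_, fun m => ?_⟩
    · exact contDiff_zero.2 (continuous_iff_continuousAt.2 fun x => (hasFDerivAt_int μ H x).continuousAt)
    · obtain ⟨C, hC⟩ := slice_bound H m μ.integrablePower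
      refine ⟨∫ τ, C * (1 + ‖τ‖) ^ (-(μ.integrablePower : ℝ)) ∂μ, fun x => ?_⟩
      rw [norm_iteratedFDeriv_zero]
      calc ‖x‖ ^ m * ‖∫ τ, H (τ, x) ∂μ‖ ≤ ‖x‖ ^ m * ∫ τ, ‖H (τ, x)‖ ∂μ := by
            gcongr; exact norm_integral_le_integral_norm _
        _ = ∫ τ, ‖x‖ ^ m * ‖H (τ, x)‖ ∂μ := by rw [integral_const_mul]
        _ ≤ _ := by
            refine integral_mono ((slice_integrable μ H x).norm.const_mul _)
              (μ.integrable_pow_neg_integrablePower.const_mul C) fun τ => hC τ x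
  | succ n ih =>
    intro F _ _ H
    have hfd : fderiv ℝ (fun x => ∫ τ, H (τ, x) ∂μ) = fun x => ∫ τ, dsnd H (τ, x) ∂μ :=
      funext fun x => (hasFDerivAt_int μ H x).fderiv
    obtain ⟨h1, h2⟩ := ih (dsnd H)
    refine ⟨?_, fun m => ?_⟩
    · push_cast
      rw [contDiff_succ_iff_fderiv]
      refine ⟨fun x => (hasFDerivAt_int μ H x).differentiableAt, by simp, ?_⟩
      rw [hfd]; exact h1
    · obtain ⟨C, hC⟩ := h2 m
      refine ⟨C, fun x => ?_⟩
      rw [← norm_iteratedFDeriv_fderiv, hfd]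
      exact hC x

/-- Integration in the first variable. -/
noncomputable def intS {F : Type} [NormedAddCommGroup F] [NormedSpace ℝ F]
    (μ : Measure ℝ) [μ.HasTemperateGrowth] (H : 𝓢(ℝ × X, F)) : 𝓢(X, F) where
  toFun := fun x => ∫ τ, H (τ, x) ∂μ
  smooth' := contDiff_infty.2 fun n => (int_aux μ n H).1
  decay' := fun k n => (int_aux μ n H).2 k

theorem intS_apply {F : Type} [NormedAddCommGroup F] [NormedSpace ℝ F]
    (μ : Measure ℝ) [μ.HasTemperateGrowth] (H : 𝓢(ℝ × X, F)) (x : X) :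
    intS μ H x = ∫ τ, H (τ, x) ∂μ := rfl

/-- Tensor product. -/
theorem tensor {Y : Type} [NormedAddCommGroup Y] [NormedSpace ℝ Y]
    (f : 𝓢(Y, ℂ)) (g : 𝓢(X, ℂ)) : ∃ h : 𝓢(Y × X, ℂ), ∀ y x, h (y, x) = f y * g x := by
  refine ⟨⟨fun p => f p.1 * g p.2, ?_, ?_⟩, fun _ _ => rfl⟩
  · exact ((f.smooth ⊤).comp contDiff_fst).mul ((g.smooth ⊤).comp contDiff_snd)
  · intro k n
    have key : ∀ i : ℕ, ∃ C, ∀ p : Y × X, ‖p‖ ^ k *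
        (‖iteratedFDeriv ℝ i (f ∘ Prod.fst) p‖ * ‖iteratedFDeriv ℝ (n - i) (g ∘ Prod.snd) p‖) ≤ C := by
      intro i
      obtain ⟨C1, p1, h1⟩ := f.decay k i
      obtain ⟨C2, p2, h2⟩ := f.decay 0 i
      obtain ⟨C3, p3, h3⟩ := g.decay k (n - i)
      obtain ⟨C4, p4, h4⟩ := g.decay 0 (n - i)
      refine ⟨C1 * C4 + C2 * C3, fun p => ?_⟩
      have hf : ‖iteratedFDeriv ℝ i (f ∘ Prod.fst) p‖ ≤ ‖iteratedFDeriv ℝ i f p.1‖ := by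
        have := (ContinuousLinearMap.fst ℝ Y X).iteratedFDeriv_comp_right (f.smooth ⊤) p
          (i := i) (nle _)
        change ‖iteratedFDeriv ℝ i (f ∘ (ContinuousLinearMap.fst ℝ Y X)) p‖ ≤ _
        rw [this]
        refine (ContinuousMultilinearMap.norm_compContinuousLinearMap_le _ _).trans ?_
        refine mul_le_of_le_one_right (norm_nonneg _) ?_
        exact Finset.prod_le_one (fun _ _ => norm_nonneg _)
          (fun _ _ => ContinuousLinearMap.norm_fst_le _ _ _)
      have hg : ‖iteratedFDeriv ℝ (n - i) (g ∘ Prod.snd) p‖ ≤ ‖iteratedFDeriv ℝ (n - i) g p.2‖ := by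
        have := (ContinuousLinearMap.snd ℝ Y X).iteratedFDeriv_comp_right (g.smooth ⊤) p
          (i := n - i) (nle _)
        change ‖iteratedFDeriv ℝ (n - i) (g ∘ (ContinuousLinearMap.snd ℝ Y X)) p‖ ≤ _
        rw [this]
        refine (ContinuousMultilinearMap.norm_compContinuousLinearMap_le _ _).trans ?_
        refine mul_le_of_le_one_right (norm_nonneg _) ?_
        exact Finset.prod_le_one (fun _ _ => norm_nonneg _)
          (fun _ _ => ContinuousLinearMap.norm_snd_le _ _ _)
      have hp : ‖p‖ ^ k ≤ ‖p.1‖ ^ k + ‖p.2‖ ^ k := by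
        rcases le_total ‖p.1‖ ‖p.2‖ with h | h
        · rw [Prod.norm_def, max_eq_right h]
          exact le_add_of_nonneg_left (by positivity)
        · rw [Prod.norm_def, max_eq_left h]
          exact le_add_of_nonneg_right (by positivity)
      have e1 := h1 p.1
      have e2 := h2 p.1
      have e3 := h3 p.2
      have e4 := h4 p.2
      simp only [pow_zero, one_mul] at e2 e4
      calc _ ≤ (‖p.1‖ ^ k + ‖p.2‖ ^ k) *
            (‖iteratedFDeriv ℝ i f p.1‖ * ‖iteratedFDeriv ℝ (n - i) g p.2‖) := by gcongr
        _ = (‖p.1‖ ^ k * ‖iteratedFDeriv ℝ i f p.1‖) * ‖iteratedFDeriv ℝ (n - i) g p.2‖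
            + ‖iteratedFDeriv ℝ i f p.1‖ * (‖p.2‖ ^ k * ‖iteratedFDeriv ℝ (n - i) g p.2‖) := by ring
        _ ≤ _ := by gcongr
    choose C hC using key
    refine ⟨∑ i ∈ Finset.range (n + 1), (n.choose i : ℝ) * C i, fun p => ?_⟩
    have := norm_iteratedFDeriv_smul_le (𝕜 := ℝ) (f := f ∘ (Prod.fst : Y × X → Y))
      (g := g ∘ (Prod.snd : Y × X → X))
      ((f.smooth ⊤).comp contDiff_fst) ((g.smooth ⊤).comp contDiff_snd) p (n := n)
      (nle _)
    refine (mul_le_mul_of_nonneg_left this (by positivity : 0 ≤ ‖p‖ ^ k)).trans ?_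
    rw [Finset.mul_sum]
    refine Finset.sum_le_sum fun i _ => ?_
    calc _ = (n.choose i : ℝ) * (‖p‖ ^ k *
            (‖iteratedFDeriv ℝ i (f ∘ Prod.fst) p‖ * ‖iteratedFDeriv ℝ (n - i) (g ∘ Prod.snd) p‖)) := by ring
      _ ≤ _ := by gcongr; exact hC i p

theorem temperate_inv {Y : Type} [NormedAddCommGroup Y] [NormedSpace ℝ Y] {f : Y → ℝ}
    (hf : f.HasTemperateGrowth) (h1 : ∀ x, 1 ≤ f x) :
    (fun x => (f x)⁻¹).HasTemperateGrowth := by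
  have ho : IsOpen (Set.Ioi (1 / 2 : ℝ)) := isOpen_Ioi
  have hne : ∀ x ∈ Set.Ioi (1 / 2 : ℝ), x ≠ 0 := fun x hx =>
    (lt_trans (by norm_num) (Set.mem_Ioi.1 hx)).ne'
  refine Function.HasTemperateGrowth.comp' (g := fun y : ℝ => y⁻¹) (t := Set.Ioi (1 / 2 : ℝ))
    ?_ ho.uniqueDiffOn ?_ ?_ hf
  · rintro - ⟨x, rfl⟩
    exact lt_of_lt_of_le (by norm_num) (h1 x)
  · exact contDiffOn_id.inv hne
  · intro N
    refine ⟨0, (N.factorial : ℝ) * 2 ^ (N + 1), by positivity, fun n hn x hx => ?_⟩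
    have hx0 : (0 : ℝ) < x := lt_trans (by norm_num) (Set.mem_Ioi.1 hx)
    rw [iteratedFDerivWithin_of_isOpen n ho hx, norm_iteratedFDeriv_eq_norm_iteratedDeriv,
      iteratedDeriv_eq_iterate, iter_deriv_inv]
    rw [norm_mul, norm_mul, norm_pow, norm_neg, norm_one, one_pow, one_mul, pow_zero, mul_one]
    have h2 : ‖x ^ (-1 - n : ℤ)‖ ≤ 2 ^ (N + 1) := by
      have e : x ^ (-1 - n : ℤ) = (x⁻¹) ^ (n + 1) := by
        rw [show (-1 - n : ℤ) = -((n + 1 : ℕ) : ℤ) by push_cast; ring, zpow_neg, zpow_natCast, inv_pow]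
      rw [e, norm_pow, Real.norm_of_nonneg (by positivity)]
      have : x⁻¹ ≤ 2 := by
        rw [inv_le_comm₀ hx0 (by norm_num)]
        have := Set.mem_Ioi.1 hx
        linarith
      calc (x⁻¹) ^ (n + 1) ≤ 2 ^ (n + 1) := by gcongr
        _ ≤ 2 ^ (N + 1) := by gcongr; norm_num
    have h3 : ‖(n.factorial : ℝ)‖ ≤ N.factorial := by
      rw [Real.norm_of_nonneg (by positivity)]
      exact_mod_cast Nat.factorial_le hn
    gcongr

theorem dil (b χ : 𝓢(ℝ, ℂ)) (f : 𝓢(ℝ × X, ℂ)) :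
    ∃ H : 𝓢(ℝ × (ℝ × X), ℂ), ∀ τ ρ σ, H (τ, (ρ, σ)) = b τ * (χ ρ * f (τ * ρ, σ)) := by
  obtain ⟨h1, hh1⟩ := tensor χ f
  obtain ⟨h2, hh2⟩ := tensor b h1
  let Θ : ℝ × (ℝ × X) → ℝ × (ℝ × (ℝ × X)) := fun p => (p.1, (p.2.1, (p.1 * p.2.1, p.2.2)))
  have hfst : (fun p : ℝ × (ℝ × X) => p.1).HasTemperateGrowth :=
    (ContinuousLinearMap.fst ℝ ℝ (ℝ × X)).hasTemperateGrowth
  have hsnd : (fun p : ℝ × (ℝ × X) => p.2.1).HasTemperateGrowth :=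
    ((ContinuousLinearMap.fst ℝ ℝ X).comp (ContinuousLinearMap.snd ℝ ℝ (ℝ × X))).hasTemperateGrowth
  let L : ℝ × (ℝ × X) →L[ℝ] ℝ × (ℝ × (ℝ × X)) :=
    (ContinuousLinearMap.fst ℝ ℝ (ℝ × X)).prod
      (((ContinuousLinearMap.fst ℝ ℝ X).comp (ContinuousLinearMap.snd ℝ ℝ (ℝ × X))).prod
        ((0 : ℝ × (ℝ × X) →L[ℝ] ℝ).prod
          ((ContinuousLinearMap.snd ℝ ℝ X).comp (ContinuousLinearMap.snd ℝ ℝ (ℝ × X)))))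
  have hΘ : Θ.HasTemperateGrowth := by
    have e : Θ = fun p => L p + (p.1 * p.2.1) • ((0, (0, (1, 0))) : ℝ × (ℝ × (ℝ × X))) := by
      funext p
      simp [Θ, L]
    rw [e]
    exact L.hasTemperateGrowth.fun_add
      ((hfst.fun_mul hsnd).fun_smul (Function.HasTemperateGrowth.const _))
  refine ⟨compCLM ℝ hΘ ⟨1, 1, fun p => ?_⟩ h2, fun τ ρ σ => ?_⟩
  · have : ‖p‖ ≤ ‖Θ p‖ := by
      obtain ⟨a, c, d⟩ := p
      simp only [Θ, Prod.norm_def]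
      refine max_le (le_max_left _ _) (max_le ?_ ?_)
      · exact le_max_of_le_right (le_max_left _ _)
      · exact le_max_of_le_right (le_max_of_le_right (le_max_right _ _))
    simp only [pow_one, one_mul]
    linarith
  · simp [Θ, hh1, hh2]

/-- A smooth bump, as a complex Schwartz function. -/
theorem exists_bump (R : ℝ) (hR : 0 < R) : ∃ χ : ContDiffBump (0 : ℝ), (∀ x, |x| ≤ R → χ x = 1) := by
  refine ⟨⟨R, R + 1, hR, by linarith⟩, fun x hx => ?_⟩
  apply ContDiffBump.one_of_mem_closedBall
  simpa using hx

/-- Turn a compactly supported smooth real function into a complex Schwartz function. -/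
theorem exists_schwartz (f : ℝ → ℝ) (hf : ContDiff ℝ ∞ f) (hc : HasCompactSupport f) :
    ∃ g : 𝓢(ℝ, ℂ), ∀ x, g x = (f x : ℂ) := by
  have h1 : HasCompactSupport (fun x => (f x : ℂ)) := hc.comp_left (g := Complex.ofReal) rfl
  have h2 : ContDiff ℝ ∞ (fun x => (f x : ℂ)) := Complex.ofRealCLM.contDiff.comp hf
  exact ⟨h1.toSchwartzMap h2, fun x => rfl⟩

theorem hadamard (k : 𝓢(ℝ × X, ℂ)) (hk : ∀ σ, k (0, σ) = 0) :
    ∃ h : 𝓢(ℝ × X, ℂ), ∀ w σ, k (w, σ) = (w : ℂ) * h (w, σ) := by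
  obtain ⟨χ, hχ⟩ := exists_bump 1 one_pos
  obtain ⟨b, hb⟩ := exists_schwartz χ χ.contDiff χ.hasCompactSupport
  have hχt : (fun x : ℝ => χ x).HasTemperateGrowth := χ.hasCompactSupport.hasTemperateGrowth χ.contDiff
  have hDt : (fun x : ℝ => x ^ 2 + χ x).HasTemperateGrowth :=
    (Function.HasTemperateGrowth.id'.fun_pow 2).fun_add hχt
  have hD1 : ∀ x : ℝ, 1 ≤ x ^ 2 + χ x := by
    intro x
    rcases le_total |x| 1 with h | h
    · rw [hχ x h]; nlinarith [sq_nonneg x]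
    · have := χ.nonneg (x := x)
      have : 1 ≤ x ^ 2 := by rw [← sq_abs]; nlinarith
      linarith
  have hinv := temperate_inv hDt hD1
  have hct : (fun x : ℝ => χ x * (x ^ 2 + χ x)⁻¹).HasTemperateGrowth := hχt.fun_mul hinv
  obtain ⟨c, hc⟩ := exists_schwartz (fun x => χ x * (x ^ 2 + χ x)⁻¹) hct.1 χ.hasCompactSupport.mul_right
  have hq : (fun p : ℝ × X => p.1 * (p.1 ^ 2 + χ p.1)⁻¹).HasTemperateGrowth :=
    (Function.HasTemperateGrowth.id'.fun_mul hinv).comp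
      (ContinuousLinearMap.fst ℝ ℝ X).hasTemperateGrowth
  let dk : 𝓢(ℝ × X, ℂ) := SchwartzMap.evalCLM ℝ (ℝ × X) ℂ (1, 0) (fderivCLM ℝ (ℝ × X) ℂ k)
  obtain ⟨H, hH⟩ := dil b c dk
  refine ⟨smulLeftCLM ℂ (fun p : ℝ × X => p.1 * (p.1 ^ 2 + χ p.1)⁻¹) k +
    intS (volume.restrict (Set.Ioc (0 : ℝ) 1)) H, fun w σ => ?_⟩
  have hintg : intS (volume.restrict (Set.Ioc (0 : ℝ) 1)) H (w, σ) =
      c w * ∫ τ in (0 : ℝ)..1, dk (τ * w, σ) := by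
    rw [intS_apply, intervalIntegral.integral_of_le zero_le_one, ← integral_const_mul]
    refine setIntegral_congr_fun measurableSet_Ioc fun τ hτ => ?_
    simp only [hH, hb]
    rw [hχ τ (abs_le.2 ⟨by linarith [hτ.1], hτ.2⟩)]
    simp
  have hftc : (w : ℂ) * ∫ τ in (0 : ℝ)..1, dk (τ * w, σ) = k (w, σ) := by
    have hd : ∀ τ : ℝ, HasDerivAt (fun τ : ℝ => k (τ * w, σ)) ((w : ℂ) * dk (τ * w, σ)) τ := by
      intro τ
      have h1 := k.hasFDerivAt (τ * w, σ)
      have h2 : HasDerivAt (fun τ : ℝ => (τ * w, σ)) (w, (0 : X)) τ :=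
        (hasDerivAt_mul_const w).prodMk (hasDerivAt_const _ _)
      have h3 := h1.comp_hasDerivAt τ h2
      have e : ((w, (0 : X)) : ℝ × X) = w • ((1, 0) : ℝ × X) := by simp
      rw [e, map_smul] at h3
      exact h3
    rw [← intervalIntegral.integral_const_mul,
      intervalIntegral.integral_eq_sub_of_hasDerivAt (fun τ _ => hd τ)]
    · simp [hk]
    · apply Continuous.intervalIntegrable
      exact continuous_const.mul (dk.continuous.comp (by fun_prop))
  rw [add_apply, smulLeftCLM_apply_apply hq, hintg, mul_add, mul_left_comm, hftc, hc]
  have hne : ((w : ℂ) ^ 2 + (χ w : ℂ)) ≠ 0 := by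
    have := hD1 w
    exact_mod_cast (by linarith : (0 : ℝ) < w ^ 2 + χ w).ne'
  simp only [Complex.real_smul]
  push_cast
  field_simp

theorem exists_V : ∃ V : 𝓢(ℝ, ℂ), ∀ k : ℕ, ∫ x : ℝ, ((-(x : ℂ) ^ 2) ^ k) * V x = 1 := by
  obtain ⟨χ, hχ⟩ := exists_bump 1 one_pos
  obtain ⟨W, hW⟩ := exists_schwartz (fun x => Real.exp (2 * π * x) * χ x)
    (((contDiff_const.mul contDiff_id).exp).mul χ.contDiff) χ.hasCompactSupport.mul_left
  let V : 𝓢(ℝ, ℂ) := FourierTransformInv.fourierInv W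
  have hVW : FourierTransform.fourier (V : ℝ → ℂ) = W := by
    rw [← SchwartzMap.fourier_coe]
    simp [V]
  have hloc : ∀ n : ℕ, iteratedDeriv n (W : ℝ → ℂ) =ᶠ[nhds 0]
      fun x : ℝ => ((2 * π : ℂ)) ^ n * Complex.exp (2 * π * x) := by
    intro n
    induction n with
    | zero =>
      filter_upwards [Metric.closedBall_mem_nhds (0 : ℝ) one_pos] with x hx
      rw [iteratedDeriv_zero, hW, hχ x (by simpa using hx)]
      simp
    | succ n ih =>
      rw [iteratedDeriv_succ]
      refine ih.deriv.trans (Filter.Eventually.of_forall fun x => ?_)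
      have h1 : HasDerivAt (fun x : ℝ => (2 * π * x : ℂ)) (2 * π) x := by
        simpa using (hasDerivAt_id x).ofReal_comp.const_mul (2 * π : ℂ)
      have := (h1.cexp.const_mul ((2 * π : ℂ) ^ n)).deriv
      simp only [this]
      ring
  have hintg : ∀ n : ℕ, Integrable (fun x : ℝ => x ^ n • V x) := by
    intro n
    have ht : (fun x : ℝ => x ^ n).HasTemperateGrowth := Function.HasTemperateGrowth.id'.fun_pow n
    have := (smulLeftCLM ℂ (fun x : ℝ => x ^ n) V).integrable (μ := volume)
    refine this.congr (Filter.Eventually.of_forall fun x => ?_)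
    simp [smulLeftCLM_apply_apply ht]
  refine ⟨V, fun k => ?_⟩
  have h1 := Real.iteratedDeriv_fourier (f := V) (N := ⊤) (n := 2 * k) (fun n _ => hintg n) le_top
  rw [hVW] at h1
  have h2 := congrFun h1 0
  rw [(hloc (2 * k)).eq_of_nhds, Real.fourier_eq] at h2
  simp only [Complex.ofReal_zero, mul_zero, Complex.exp_zero, mul_one, inner_zero_right, neg_zero,
    AddChar.map_zero_eq_one, one_smul, smul_eq_mul] at h2
  have hpi : ((2 * π : ℂ)) ^ (2 * k) ≠ 0 := pow_ne_zero _ (by simp [Real.pi_ne_zero])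
  apply mul_left_cancel₀ hpi
  rw [← integral_const_mul, mul_one]
  refine Eq.trans ?_ h2.symm
  congr 1
  funext x
  rw [← mul_assoc, pow_mul, pow_mul, ← mul_pow]
  congr 2
  ring_nf
  simp

theorem even_step (f : 𝓢(ℝ × X, ℂ)) (hf : ∀ w σ, f (-w, σ) = f (w, σ)) :
    ∃ g : 𝓢(ℝ × X, ℂ), (∀ w σ, g (-w, σ) = g (w, σ)) ∧
      ∀ x : ℝ × X, fderiv ℝ f x (1, 0) = (2 * x.1) • g x := by
  let k : 𝓢(ℝ × X, ℂ) := SchwartzMap.evalCLM ℝ (ℝ × X) ℂ (1, 0) (fderivCLM ℝ (ℝ × X) ℂ f)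
  have hk : ∀ w σ, HasDerivAt (fun w : ℝ => f (w, σ)) (k (w, σ)) w := by
    intro w σ
    exact (f.hasFDerivAt (w, σ)).comp_hasDerivAt w ((hasDerivAt_id w).prodMk (hasDerivAt_const _ _))
  have hodd : ∀ w σ, k (-w, σ) = -k (w, σ) := by
    intro w σ
    have h1 : HasDerivAt (fun w : ℝ => f (-w, σ)) (-k (-w, σ)) w := by
      have := (hk (-w) σ).scomp w (hasDerivAt_neg w)
      rw [neg_one_smul] at this
      exact this
    simp only [hf] at h1
    rw [← h1.unique (hk w σ), neg_neg]
  obtain ⟨h, hh⟩ := hadamard k (fun σ => by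
    have := hodd 0 σ
    rw [neg_zero] at this
    exact self_eq_neg.1 this)
  refine ⟨(1 / 2 : ℝ) • h, fun w σ => ?_, fun x => ?_⟩
  · by_cases hw : w = 0
    · simp [hw]
    · have e := hodd w σ
      rw [hh, hh] at e
      have hw' : (w : ℂ) ≠ 0 := by exact_mod_cast hw
      have : h (-w, σ) = h (w, σ) := by
        apply mul_left_cancel₀ hw'
        push_cast at e
        linear_combination -e
      simp [this]
  · change k x = _
    obtain ⟨w, σ⟩ := x
    rw [hh]
    simp
    ring

/-- Data for the gluing. -/
structure Glue {F : Type} [NormedAddCommGroup F] [NormedSpace ℝ F]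
    (P Q : ℕ → 𝓢(ℝ × X, F)) : Prop where
  hP : ∀ k x, fderiv ℝ (P k) x (1, 0) = (2 * x.1) • P (k + 1) x
  hQ : ∀ k x, |x.1| < 1 → fderiv ℝ (Q k) x (1, 0) = (-2 * x.1) • Q (k + 1) x
  h0 : ∀ k σ, P k (0, σ) = Q k (0, σ)

theorem exists_glue (f : 𝓢(ℝ × X, ℂ)) (hf : ∀ w σ, f (-w, σ) = f (w, σ)) :
    ∃ P Q : ℕ → 𝓢(ℝ × X, ℂ), P 0 = f ∧ Glue P Q := by
  choose! S hS1 hS2 using (even_step (X := X))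
  let P : ℕ → 𝓢(ℝ × X, ℂ) := fun k => S^[k] f
  have hPs : ∀ k, P (k + 1) = S (P k) := fun k => Function.iterate_succ_apply' S k f
  have hPe : ∀ k w σ, P k (-w, σ) = P k (w, σ) := by
    intro k
    induction k with
    | zero => exact hf
    | succ k ih => rw [hPs]; exact hS1 _ ih
  have hP : ∀ k x, fderiv ℝ (P k) x (1, 0) = (2 * x.1) • P (k + 1) x := by
    intro k x
    rw [hPs]; exact hS2 _ (hPe k) x
  obtain ⟨V, hV⟩ := exists_V
  obtain ⟨η, hη⟩ := exists_bump 1 one_pos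
  obtain ⟨c, hc⟩ := exists_schwartz η η.contDiff η.hasCompactSupport
  let b : ℕ → 𝓢(ℝ, ℂ) := fun k => smulLeftCLM ℂ (fun x : ℝ => (-x ^ 2) ^ k) V
  have hb : ∀ k x, b k x = ((-(x : ℂ) ^ 2) ^ k) * V x := by
    intro k x
    have ht : (fun x : ℝ => (-x ^ 2) ^ k).HasTemperateGrowth :=
      (Function.HasTemperateGrowth.id'.fun_pow 2).fun_neg.fun_pow k
    simp only [b, smulLeftCLM_apply_apply ht]
    rw [Complex.real_smul]
    push_cast
    rfl
  have hex : ∀ k, ∃ H : 𝓢(ℝ × (ℝ × X), ℂ), ∀ τ ρ σ,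
      H (τ, (ρ, σ)) = b k τ * (c ρ * P k (τ * ρ, σ)) := fun k => dil (b k) c (P k)
  choose H hH using hex
  have hc1 : ∀ ρ : ℝ, |ρ| ≤ 1 → c ρ = 1 := fun ρ hρ => by rw [hc, hη ρ hρ]; simp
  refine ⟨P, fun k => intS volume (H k), rfl, hP, ?_, ?_⟩
  · rintro k ⟨ρ, σ⟩ hρ
    have h1 : HasFDerivAt (intS volume (H k)) (∫ τ, dsnd (H k) (τ, (ρ, σ))) (ρ, σ) :=
      hasFDerivAt_int volume (H k) (ρ, σ)
    rw [h1.fderiv, ContinuousLinearMap.integral_apply (slice_integrable volume (dsnd (H k)) (ρ, σ)),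
      intS_apply, ← integral_smul]
    congr 1
    funext τ
    have h2 : HasDerivAt (fun r : ℝ => H k (τ, (r, σ))) (dsnd (H k) (τ, (ρ, σ)) (1, 0)) ρ := by
      rw [dsnd_apply]
      exact ((H k).hasFDerivAt (τ, (ρ, σ))).comp_hasDerivAt ρ
        ((hasDerivAt_const _ _).prodMk ((hasDerivAt_id ρ).prodMk (hasDerivAt_const _ _)))
    have h3 : HasDerivAt (fun r : ℝ => P k (τ * r, σ)) (τ • ((2 * (τ * ρ)) • P (k + 1) (τ * ρ, σ))) ρ := by
      have := ((P k).hasFDerivAt (τ * ρ, σ)).comp_hasDerivAt ρ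
        ((hasDerivAt_const_mul τ).prodMk (hasDerivAt_const ρ σ))
      have e : ((τ, (0 : X)) : ℝ × X) = τ • ((1, 0) : ℝ × X) := by simp
      rw [e, map_smul, hP] at this
      exact this
    have h4 : (fun r : ℝ => H k (τ, (r, σ))) =ᶠ[nhds ρ] fun r => b k τ * P k (τ * r, σ) := by
      have : ∀ᶠ r in nhds ρ, |r| < 1 := (continuous_abs.tendsto ρ).eventually_lt_const hρ
      filter_upwards [this] with r hr
      rw [hH, hc1 r hr.le, one_mul]
    rw [h2.unique ((h3.const_mul (b k τ)).congr_of_eventuallyEq h4), hH, hc1 ρ hρ.le, hb, hb]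
    simp only [Complex.real_smul]
    push_cast
    ring
  · intro k σ
    rw [intS_apply]
    have : ∀ τ : ℝ, H k (τ, (0, σ)) = ((-(τ : ℂ) ^ 2) ^ k) * V τ * P k (0, σ) := by
      intro τ
      rw [hH, hc1 0 (by simp), hb, mul_zero, one_mul]
    simp only [this]
    rw [integral_mul_const, hV, one_mul]

section
variable {F : Type} [NormedAddCommGroup F] [NormedSpace ℝ F]

/-- The glued function. -/
noncomputable def gl (P Q : 𝓢(ℝ × X, F)) (x : ℝ × X) : F :=
  if 0 ≤ x.1 then P (√x.1, x.2) else Q (√(-x.1), x.2)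

theorem continuous_gl {P Q : 𝓢(ℝ × X, F)} (h : ∀ σ, P (0, σ) = Q (0, σ)) :
    Continuous (gl P Q) := by
  refine Continuous.if_le (P.continuous.comp (by fun_prop)) (Q.continuous.comp (by fun_prop))
    continuous_const continuous_fst ?_
  intro x hx
  rw [← hx]
  simp [h]

theorem gl_deriv_of_ne {P Q P1 Q1 : 𝓢(ℝ × X, F)}
    (hP : ∀ x, fderiv ℝ P x (1, 0) = (2 * x.1) • P1 x)
    (hQ : ∀ x, |x.1| < 1 → fderiv ℝ Q x (1, 0) = (-2 * x.1) • Q1 x)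
    (σ : X) (s : ℝ) (hs : -1 < s) (hs0 : s ≠ 0) :
    HasDerivAt (fun s => gl P Q (s, σ)) (gl P1 Q1 (s, σ)) s := by
  rcases lt_or_gt_of_ne hs0 with h | h
  · have hn : ¬ (0 ≤ s) := not_le.2 h
    have hpos : 0 < √(-s) := Real.sqrt_pos.2 (by linarith)
    have hlt : |√(-s)| < 1 := by
      rw [abs_of_pos hpos]
      calc √(-s) < √1 := Real.sqrt_lt_sqrt (by linarith) (by linarith)
        _ = 1 := Real.sqrt_one
    have h1 : HasDerivAt (fun s : ℝ => √(-s)) (-1 / (2 * √(-s))) s :=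
      (hasDerivAt_neg s).sqrt (by linarith)
    have h2 := (Q.hasFDerivAt (√(-s), σ)).comp_hasDerivAt s (h1.prodMk (hasDerivAt_const s σ))
    have e : ((-1 / (2 * √(-s)), (0 : X)) : ℝ × X) = (-1 / (2 * √(-s))) • ((1, 0) : ℝ × X) := by simp
    rw [e, map_smul, hQ _ hlt, smul_smul] at h2
    have e2 : (-1 / (2 * √(-s))) * (-2 * √(-s)) = 1 := by field_simp
    simp only [e2, one_smul] at h2
    have e3 : gl P1 Q1 (s, σ) = Q1 (√(-s), σ) := by simp [gl, hn]
    rw [e3]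
    refine h2.congr_of_eventuallyEq ?_
    filter_upwards [gt_mem_nhds h] with t ht
    simp [gl, not_le.2 ht]
  · have hpos : 0 < √s := Real.sqrt_pos.2 h
    have h1 : HasDerivAt (fun s : ℝ => √s) (1 / (2 * √s)) s := (hasDerivAt_id s).sqrt h.ne'
    have h2 := (P.hasFDerivAt (√s, σ)).comp_hasDerivAt s (h1.prodMk (hasDerivAt_const s σ))
    have e : ((1 / (2 * √s), (0 : X)) : ℝ × X) = (1 / (2 * √s)) • ((1, 0) : ℝ × X) := by simp
    rw [e, map_smul, hP, smul_smul] at h2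
    have e2 : (1 / (2 * √s)) * (2 * √s) = 1 := by field_simp
    simp only [e2, one_smul] at h2
    have e3 : gl P1 Q1 (s, σ) = P1 (√s, σ) := by simp [gl, h.le]
    rw [e3]
    refine h2.congr_of_eventuallyEq ?_
    filter_upwards [lt_mem_nhds h] with t ht
    simp [gl, ht.le]

theorem gl_deriv {P Q P1 Q1 : 𝓢(ℝ × X, F)}
    (hP : ∀ x, fderiv ℝ P x (1, 0) = (2 * x.1) • P1 x)
    (hQ : ∀ x, |x.1| < 1 → fderiv ℝ Q x (1, 0) = (-2 * x.1) • Q1 x)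
    (h0 : ∀ σ, P (0, σ) = Q (0, σ)) (h1 : ∀ σ, P1 (0, σ) = Q1 (0, σ))
    (σ : X) (s : ℝ) (hs : -1 < s) :
    HasDerivAt (fun s => gl P Q (s, σ)) (gl P1 Q1 (s, σ)) s := by
  by_cases hs0 : s = 0
  swap
  · exact gl_deriv_of_ne hP hQ σ s hs hs0
  subst hs0
  have hc : Continuous (fun s => gl P Q (s, σ)) := (continuous_gl h0).comp (by fun_prop)
  have hc1 : Continuous (fun s => gl P1 Q1 (s, σ)) := (continuous_gl h1).comp (by fun_prop)
  have A : HasDerivWithinAt (fun s => gl P Q (s, σ)) (gl P1 Q1 (0, σ)) (Set.Ici 0) 0 := by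
    refine hasDerivWithinAt_Ici_of_tendsto_deriv (s := Set.Ioi 0) ?_ hc.continuousWithinAt
      self_mem_nhdsWithin ?_
    · intro y hy
      exact (gl_deriv_of_ne hP hQ σ y (hs.trans hy) (ne_of_gt hy)).differentiableAt.differentiableWithinAt
    · have : Filter.Tendsto (fun s => gl P1 Q1 (s, σ)) (nhdsWithin 0 (Set.Ioi 0))
        (nhds (gl P1 Q1 (0, σ))) := (hc1.tendsto 0).mono_left nhdsWithin_le_nhds
      refine this.congr' ?_
      filter_upwards [self_mem_nhdsWithin] with y hy
      exact (gl_deriv_of_ne hP hQ σ y (hs.trans hy) (ne_of_gt hy)).deriv.symm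
  have B : HasDerivWithinAt (fun s => gl P Q (s, σ)) (gl P1 Q1 (0, σ)) (Set.Iic 0) 0 := by
    have hmem : Set.Ioo (-1 : ℝ) 0 ∈ nhdsWithin 0 (Set.Iio 0) := Ioo_mem_nhdsLT (by norm_num)
    refine hasDerivWithinAt_Iic_of_tendsto_deriv (s := Set.Ioo (-1) 0) ?_ hc.continuousWithinAt
      hmem ?_
    · intro y hy
      exact (gl_deriv_of_ne hP hQ σ y hy.1 (ne_of_lt hy.2)).differentiableAt.differentiableWithinAt
    · have : Filter.Tendsto (fun s => gl P1 Q1 (s, σ)) (nhdsWithin 0 (Set.Iio 0))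
        (nhds (gl P1 Q1 (0, σ))) := (hc1.tendsto 0).mono_left nhdsWithin_le_nhds
      refine this.congr' ?_
      filter_upwards [hmem] with y hy
      exact (gl_deriv_of_ne hP hQ σ y hy.1 (ne_of_lt hy.2)).deriv.symm
  have := B.union A
  rwa [Set.Iic_union_Ici, hasDerivWithinAt_univ] at this

theorem dsnd_slice (P : 𝓢(ℝ × X, F)) (w : ℝ) (σ : X) :
    HasFDerivAt (fun σ => P (w, σ)) (dsnd P (w, σ)) σ :=
  (P.hasFDerivAt (w, σ)).comp σ (hasFDerivAt_prodMk_right w σ)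

theorem dsnd_zero {P Q : 𝓢(ℝ × X, F)} (h : ∀ σ, P (0, σ) = Q (0, σ)) (σ : X) :
    dsnd P (0, σ) = dsnd Q (0, σ) := by
  have h1 := dsnd_slice P 0 σ
  have h2 := dsnd_slice Q 0 σ
  simp only [h] at h1
  exact h1.unique h2

theorem dsnd_step (c : ℝ) (P P1 : 𝓢(ℝ × X, F)) (x : ℝ × X)
    (h : ∀ᶠ y in nhds x, fderiv ℝ P y (1, 0) = (c * y.1) • P1 y) :
    fderiv ℝ (dsnd P) x (1, 0) = (c * x.1) • dsnd P1 x := by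
  have hd : HasFDerivAt (fderiv ℝ P) (fderiv ℝ (fderiv ℝ P) x) x :=
    (fderivCLM ℝ (ℝ × X) F P).hasFDerivAt x
  have e1 : HasFDerivAt (dsnd P) _ x :=
    (((ContinuousLinearMap.compL ℝ X (ℝ × X) F).flip
      (ContinuousLinearMap.inr ℝ ℝ X)).hasFDerivAt).comp x hd
  rw [e1.fderiv]
  ext v
  have hsym : fderiv ℝ (fderiv ℝ P) x (1, 0) (0, v) = fderiv ℝ (fderiv ℝ P) x (0, v) (1, 0) :=
    second_derivative_symmetric (fun y => P.hasFDerivAt y) hd _ _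
  change fderiv ℝ (fderiv ℝ P) x (1, 0) (0, v) = (c * x.1) • (fderiv ℝ P1 x (0, v))
  rw [hsym]
  have h2 : HasFDerivAt (fun y => fderiv ℝ P y (1, 0)) _ x :=
    ((ContinuousLinearMap.apply ℝ F ((1, 0) : ℝ × X)).hasFDerivAt).comp x hd
  have h3 : HasFDerivAt (fun y : ℝ × X => (c * y.1) • P1 y) _ x :=
    ((hasFDerivAt_fst.const_mul c).smul (P1.hasFDerivAt x))
  have h4 := congrArg (fun L => L (0, v)) ((h3.congr_of_eventuallyEq h).unique h2)
  simp at h4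
  exact h4.symm

/-- Schwartz data for the derivative of the glued function. -/
noncomputable def nxt (P1 P : 𝓢(ℝ × X, F)) : 𝓢(ℝ × X, ℝ × X →L[ℝ] F) :=
  postcompCLM (ContinuousLinearMap.smulRightL ℝ (ℝ × X) F (ContinuousLinearMap.fst ℝ ℝ X)) P1 +
  postcompCLM ((ContinuousLinearMap.compL ℝ (ℝ × X) X F).flip (ContinuousLinearMap.snd ℝ ℝ X))
    (dsnd P)

theorem nxt_apply (P1 P : 𝓢(ℝ × X, F)) (x : ℝ × X) :
    nxt P1 P x = (ContinuousLinearMap.fst ℝ ℝ X).smulRight (P1 x) +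
      (dsnd P x).comp (ContinuousLinearMap.snd ℝ ℝ X) := rfl

theorem nxt_step (c : ℝ) (P P1 P2 : 𝓢(ℝ × X, F)) (x : ℝ × X)
    (h : ∀ᶠ y in nhds x, fderiv ℝ P y (1, 0) = (c * y.1) • P1 y)
    (h' : fderiv ℝ P1 x (1, 0) = (c * x.1) • P2 x) :
    fderiv ℝ (nxt P1 P) x (1, 0) = (c * x.1) • nxt P2 P1 x := by
  have e1 : HasFDerivAt (nxt P1 P) _ x :=
    (((ContinuousLinearMap.smulRightL ℝ (ℝ × X) F (ContinuousLinearMap.fst ℝ ℝ X)).hasFDerivAt).comp x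
      (P1.hasFDerivAt x)).add
    ((((ContinuousLinearMap.compL ℝ (ℝ × X) X F).flip
      (ContinuousLinearMap.snd ℝ ℝ X)).hasFDerivAt).comp x ((dsnd P).hasFDerivAt x))
  rw [e1.fderiv]
  simp only [add_apply, ContinuousLinearMap.comp_apply, h',
    dsnd_step c P P1 x h, map_smul, nxt_apply, smul_add]
  rfl

theorem Glue.next {P Q : ℕ → 𝓢(ℝ × X, F)} (h : Glue P Q) :
    Glue (fun k => nxt (P (k + 1)) (P k)) (fun k => nxt (Q (k + 1)) (Q k)) where
  hP k x := nxt_step 2 _ _ _ x (Filter.Eventually.of_forall (h.hP k)) (h.hP (k + 1) x)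
  hQ k x hx := by
    refine nxt_step (-2) _ _ _ x ?_ (h.hQ (k + 1) x hx)
    have : ∀ᶠ y : ℝ × X in nhds x, |y.1| < 1 :=
      ((continuous_abs.comp continuous_fst).tendsto x).eventually_lt_const hx
    filter_upwards [this] with y hy
    exact h.hQ k y hy
  h0 k σ := by
    simp only [nxt_apply, h.h0 (k + 1) σ, dsnd_zero (h.h0 k) σ]

theorem gl_nxt (P1 P Q1 Q : 𝓢(ℝ × X, F)) (x : ℝ × X) :
    gl (nxt P1 P) (nxt Q1 Q) x = (ContinuousLinearMap.toSpanSingleton ℝ (gl P1 Q1 x)).coprod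
      (gl (dsnd P) (dsnd Q) x) := by
  by_cases hx : 0 ≤ x.1
  · simp only [gl, hx, if_true, nxt_apply]
    ext <;> simp
  · simp only [gl, hx, if_false, nxt_apply]
    ext <;> simp

theorem Glue.hasFDerivAt {P Q : ℕ → 𝓢(ℝ × X, F)} (h : Glue P Q) (x : ℝ × X) (hx : -1 < x.1) :
    HasFDerivAt (gl (P 0) (Q 0)) (gl (nxt (P 1) (P 0)) (nxt (Q 1) (Q 0)) x) x := by
  rw [gl_nxt]
  refine (hasStrictFDerivAt_uncurry_coprod (u := x) (f := fun s σ => gl (P 0) (Q 0) (s, σ))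
    (f₁ := fun s σ => ContinuousLinearMap.toSpanSingleton ℝ (gl (P 1) (Q 1) (s, σ)))
    (f₂ := fun s σ => gl (dsnd (P 0)) (dsnd (Q 0)) (s, σ)) ?_ ?_ ?_ ?_).hasFDerivAt
  · have : ∀ᶠ y : ℝ × X in nhds x, -1 < y.1 :=
      (continuous_fst.tendsto x).eventually_const_lt hx
    filter_upwards [this] with y hy
    exact (gl_deriv (h.hP 0) (h.hQ 0) (h.h0 0) (h.h0 1) y.2 y.1 hy).hasFDerivAt
  · refine Filter.Eventually.of_forall fun y => ?_
    by_cases hy : 0 ≤ y.1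
    · have e : gl (dsnd (P 0)) (dsnd (Q 0)) (y.1, y.2) = dsnd (P 0) (√y.1, y.2) := by simp [gl, hy]
      change HasFDerivAt _ (gl (dsnd (P 0)) (dsnd (Q 0)) (y.1, y.2)) _
      rw [e]
      simp only [gl, hy, if_true]
      exact dsnd_slice _ _ _
    · have e : gl (dsnd (P 0)) (dsnd (Q 0)) (y.1, y.2) = dsnd (Q 0) (√(-y.1), y.2) := by simp [gl, hy]
      change HasFDerivAt _ (gl (dsnd (P 0)) (dsnd (Q 0)) (y.1, y.2)) _
      rw [e]
      simp only [gl, hy, if_false]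
      exact dsnd_slice _ _ _
  · refine Continuous.continuousAt ?_
    exact (ContinuousLinearMap.toSpanSingletonCLE (𝕜 := ℝ) (E := F)).continuous.comp
      (continuous_gl (h.h0 1))
  · exact (continuous_gl (dsnd_zero (h.h0 0))).continuousAt

theorem schwartz_poly (P : 𝓢(ℝ × X, F)) (m : ℕ) : ∃ C : ℝ, ∀ y, (1 + ‖y‖) ^ m * ‖P y‖ ≤ C := by
  have := fun y => SchwartzMap.one_add_le_sup_seminorm_apply (𝕜 := ℝ) (m := (m, 0)) le_rfl le_rfl P y
  simp only [norm_iteratedFDeriv_zero] at this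
  exact ⟨_, this⟩

theorem gl_bound (P Q : 𝓢(ℝ × X, F)) (m : ℕ) :
    ∃ C : ℝ, ∀ x : ℝ × X, -1 < x.1 → ‖x‖ ^ m * ‖gl P Q x‖ ≤ C := by
  obtain ⟨C1, h1⟩ := schwartz_poly P (2 * m)
  obtain ⟨C2, h2⟩ := schwartz_poly Q (2 * m)
  refine ⟨max C1 C2, fun x hx => ?_⟩
  have hσ : ∀ r : ℝ, ‖x.2‖ ≤ (1 + ‖(r, x.2)‖) ^ 2 := by
    intro r
    have : ‖x.2‖ ≤ ‖(r, x.2)‖ := le_max_right _ _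
    nlinarith [norm_nonneg x.2]
  by_cases hs : 0 ≤ x.1
  · refine le_max_of_le_left (le_trans ?_ (h1 (√x.1, x.2)))
    simp only [gl, hs, if_true]
    rw [pow_mul]
    gcongr
    rw [Prod.norm_def]
    refine max_le ?_ (hσ _)
    have : ‖√x.1‖ ≤ ‖(√x.1, x.2)‖ := le_max_left _ _
    rw [Real.norm_of_nonneg (Real.sqrt_nonneg _)] at this
    rw [Real.norm_of_nonneg hs]
    have h3 := Real.sq_sqrt hs
    nlinarith [Real.sqrt_nonneg x.1]
  · refine le_max_of_le_right (le_trans ?_ (h2 (√(-x.1), x.2)))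
    simp only [gl, hs, if_false]
    rw [pow_mul]
    gcongr
    rw [Prod.norm_def]
    refine max_le ?_ (hσ _)
    have h3 : ‖x.1‖ ≤ 1 := by
      rw [Real.norm_eq_abs, abs_le]; constructor <;> linarith
    nlinarith [norm_nonneg (√(-x.1), x.2)]

end

theorem gl_main (n : ℕ) : ∀ {F : Type} [NormedAddCommGroup F] [NormedSpace ℝ F]
    {P Q : ℕ → 𝓢(ℝ × X, F)}, Glue P Q →
    ContDiffOn ℝ n (gl (P 0) (Q 0)) {x | -1 < x.1} ∧
    ∀ m : ℕ, ∃ C : ℝ, ∀ x : ℝ × X, -1 < x.1 →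
      ‖x‖ ^ m * ‖iteratedFDeriv ℝ n (gl (P 0) (Q 0)) x‖ ≤ C := by
  have ho : IsOpen {x : ℝ × X | -1 < x.1} := isOpen_lt continuous_const continuous_fst
  induction n with
  | zero =>
    intro F _ _ P Q h
    refine ⟨contDiffOn_zero.2 (continuous_gl (h.h0 0)).continuousOn, fun m => ?_⟩
    simpa using gl_bound (P 0) (Q 0) m
  | succ n ih =>
    intro F _ _ P Q h
    obtain ⟨h1, h2⟩ := ih h.next
    refine ⟨?_, fun m => ?_⟩
    · push_cast
      rw [contDiffOn_succ_iff_fderiv_of_isOpen ho]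
      refine ⟨fun x hx => (h.hasFDerivAt x hx).differentiableAt.differentiableWithinAt, by simp, ?_⟩
      exact h1.congr fun x hx => (h.hasFDerivAt x hx).fderiv
    · obtain ⟨C, hC⟩ := h2 m
      refine ⟨C, fun x hx => ?_⟩
      rw [← norm_iteratedFDeriv_fderiv]
      have : fderiv ℝ (gl (P 0) (Q 0)) =ᶠ[nhds x] gl (nxt (P 1) (P 0)) (nxt (Q 1) (Q 0)) := by
        filter_upwards [ho.mem_nhds hx] with y hy
        exact (h.hasFDerivAt y hy).fderiv
      rw [(this.iteratedFDeriv ℝ n).eq_of_nhds]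
      exact hC x hx

/-- The cutoff. -/
noncomputable def cut (s : ℝ) : ℝ := Real.smoothTransition (2 * s + 1)

theorem cut_contDiff : ContDiff ℝ ∞ cut :=
  (Real.smoothTransition.contDiff (n := ⊤)).comp ((contDiff_const.mul contDiff_id).add contDiff_const)

theorem cut_one {s : ℝ} (hs : 0 ≤ s) : cut s = 1 :=
  Real.smoothTransition.one_of_one_le (by linarith)

theorem cut_zero {s : ℝ} (hs : s ≤ -1 / 2) : cut s = 0 :=
  Real.smoothTransition.zero_of_nonpos (by linarith)

theorem cut_temperate : cut.HasTemperateGrowth := by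
  refine Function.HasTemperateGrowth.of_fderiv (HasCompactSupport.hasTemperateGrowth ?_ ?_)
    (cut_contDiff.differentiable (by simp)) (k := 0) (C := 1) ?_
  · refine HasCompactSupport.intro (isCompact_Icc (a := (-1 / 2 : ℝ)) (b := 0)) fun x hx => ?_
    rcases lt_or_ge x (-1 / 2) with h | h
    · have : cut =ᶠ[nhds x] fun _ => 0 := by
        filter_upwards [gt_mem_nhds h] with y hy using cut_zero hy.le
      rw [this.fderiv_eq]; simp
    · have h' : 0 < x := by
        by_contra hc
        exact hx ⟨h, not_lt.1 hc⟩
      have : cut =ᶠ[nhds x] fun _ => 1 := by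
        filter_upwards [lt_mem_nhds h'] with y hy using cut_one hy.le
      rw [this.fderiv_eq]; simp
  · exact cut_contDiff.fderiv_right (by simp)
  · intro x
    rw [pow_zero, mul_one, cut, Real.norm_of_nonneg (Real.smoothTransition.nonneg _)]
    exact Real.smoothTransition.le_one _

theorem gl_schwartz {F : Type} [NormedAddCommGroup F] [NormedSpace ℝ F]
    {P Q : ℕ → 𝓢(ℝ × X, F)} (h : Glue P Q) :
    ∃ φ : 𝓢(ℝ × X, F), ∀ s σ, 0 ≤ s → φ (s, σ) = P 0 (√s, σ) := by
  have ho : IsOpen {x : ℝ × X | -1 < x.1} := isOpen_lt continuous_const continuous_fst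
  have hct : (fun x : ℝ × X => cut x.1).HasTemperateGrowth :=
    cut_temperate.comp (ContinuousLinearMap.fst ℝ ℝ X).hasTemperateGrowth
  have hG : ContDiffOn ℝ ∞ (gl (P 0) (Q 0)) {x | -1 < x.1} :=
    contDiffOn_infty.2 fun n => (gl_main n h).1
  have hprod : ContDiffOn ℝ ∞ (fun x : ℝ × X => cut x.1 • gl (P 0) (Q 0) x) {x | -1 < x.1} :=
    hct.1.contDiffOn.smul hG
  have hz : ∀ x : ℝ × X, x.1 ≤ -1 →
      (fun x : ℝ × X => cut x.1 • gl (P 0) (Q 0) x) =ᶠ[nhds x] fun _ => 0 := by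
    intro x hx
    have : ∀ᶠ y : ℝ × X in nhds x, y.1 < -1 / 2 :=
      (continuous_fst.tendsto x).eventually_lt_const (by linarith)
    filter_upwards [this] with y hy
    rw [cut_zero hy.le, zero_smul]
  refine ⟨⟨fun x => cut x.1 • gl (P 0) (Q 0) x, ?_, ?_⟩, fun s σ hs => ?_⟩
  · rw [contDiff_iff_contDiffAt]
    intro x
    rcases lt_or_ge (-1) x.1 with hx | hx
    · exact hprod.contDiffAt (ho.mem_nhds hx)
    · exact contDiffAt_const.congr_of_eventuallyEq (hz x hx)
  · intro k n
    have key : ∀ i : ℕ, ∃ C, ∀ x : ℝ × X, -1 < x.1 → ‖x‖ ^ k *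
        (‖iteratedFDeriv ℝ i (fun x : ℝ × X => cut x.1) x‖ *
          ‖iteratedFDeriv ℝ (n - i) (gl (P 0) (Q 0)) x‖) ≤ C := by
      intro i
      obtain ⟨l, D, hD⟩ := hct.2 i
      obtain ⟨C1, h1⟩ := (gl_main (n - i) h).2 k
      obtain ⟨C2, h2⟩ := (gl_main (n - i) h).2 (k + l)
      have hD0 : 0 ≤ D := by
        have := (norm_nonneg _).trans (hD 0)
        simpa using this
      refine ⟨D * 2 ^ (l - 1) * (C1 + C2), fun x hx => ?_⟩
      have e := add_pow_le zero_le_one (norm_nonneg x) l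
      rw [one_pow] at e
      calc _ ≤ ‖x‖ ^ k * ((D * (2 ^ (l - 1) * (1 + ‖x‖ ^ l))) *
            ‖iteratedFDeriv ℝ (n - i) (gl (P 0) (Q 0)) x‖) := by
              gcongr
              exact (hD x).trans (by gcongr)
        _ = D * 2 ^ (l - 1) * (‖x‖ ^ k * ‖iteratedFDeriv ℝ (n - i) (gl (P 0) (Q 0)) x‖ +
            ‖x‖ ^ (k + l) * ‖iteratedFDeriv ℝ (n - i) (gl (P 0) (Q 0)) x‖) := by ring
        _ ≤ _ := by gcongr <;> [exact h1 x hx; exact h2 x hx]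
    choose C hC using key
    refine ⟨max 0 (∑ i ∈ Finset.range (n + 1), (n.choose i : ℝ) * C i), fun x => ?_⟩
    rcases lt_or_ge (-1) x.1 with hx | hx
    · refine le_max_of_le_right ?_
      have := norm_iteratedFDerivWithin_smul_le (𝕜 := ℝ) hct.1.contDiffOn hG ho.uniqueDiffOn
        (x := x) hx (nle n)
      rw [iteratedFDerivWithin_of_isOpen n ho hx] at this
      refine (mul_le_mul_of_nonneg_left this (by positivity : 0 ≤ ‖x‖ ^ k)).trans ?_
      rw [Finset.mul_sum]
      refine Finset.sum_le_sum fun i _ => ?_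
      rw [iteratedFDerivWithin_of_isOpen i ho hx, iteratedFDerivWithin_of_isOpen (n - i) ho hx]
      calc _ = (n.choose i : ℝ) * (‖x‖ ^ k *
            (‖iteratedFDeriv ℝ i (fun x : ℝ × X => cut x.1) x‖ *
              ‖iteratedFDeriv ℝ (n - i) (gl (P 0) (Q 0)) x‖)) := by ring
        _ ≤ _ := by gcongr; exact hC i x hx
    · refine le_max_of_le_left (le_of_eq ?_)
      rw [((hz x hx).iteratedFDeriv ℝ n).eq_of_nhds]
      change ‖x‖ ^ k * ‖iteratedFDeriv ℝ n (0 : ℝ × X → F) x‖ = 0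
      rw [iteratedFDeriv_zero]
      simp
  · change cut s • gl (P 0) (Q 0) (s, σ) = _
    rw [cut_one hs, one_smul]
    simp [gl, hs]

theorem final {E : Type} [NormedAddCommGroup E] [InnerProductSpace ℝ E]
    (ψ : 𝓢(ℝ × E, ℂ)) (hψ : ∀ w σ, ψ (-w, σ) = ψ (w, σ)) :
    ∃ g : 𝓢(ℝ × E, ℂ), ∀ (w : ℝ) (σ : E), ‖σ‖ ≤ |w| →
      g (w, σ) = (w : ℂ) * ψ (√(w ^ 2 - ‖σ‖ ^ 2), σ) := by
  obtain ⟨P, Q, hP0, hg⟩ := exists_glue ψ hψ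
  obtain ⟨φ, hφ⟩ := gl_schwartz hg
  let Θ : ℝ × E → ℝ × E := fun p => (p.1 ^ 2 - ‖p.2‖ ^ 2, p.2)
  have hfst : (fun p : ℝ × E => p.1).HasTemperateGrowth :=
    (ContinuousLinearMap.fst ℝ ℝ E).hasTemperateGrowth
  have hn : (fun p : ℝ × E => ‖p.2‖ ^ 2).HasTemperateGrowth :=
    (Function.hasTemperateGrowth_norm_sq (H := E)).comp
      (ContinuousLinearMap.snd ℝ ℝ E).hasTemperateGrowth
  have hΘ : Θ.HasTemperateGrowth := by
    have e : Θ = fun p => ((ContinuousLinearMap.inr ℝ ℝ E).comp (ContinuousLinearMap.snd ℝ ℝ E)) p +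
        (p.1 ^ 2 - ‖p.2‖ ^ 2) • ((1, 0) : ℝ × E) := by
      funext p
      simp [Θ]
    rw [e]
    exact (ContinuousLinearMap.hasTemperateGrowth _).fun_add
      (((hfst.fun_pow 2).fun_sub hn).fun_smul (Function.HasTemperateGrowth.const _))
  have hup : ∃ (k : ℕ) (C : ℝ), ∀ x, ‖x‖ ≤ C * (1 + ‖Θ x‖) ^ k := by
    refine ⟨2, 1, fun x => ?_⟩
    have h1 : |x.1 ^ 2 - ‖x.2‖ ^ 2| ≤ ‖Θ x‖ := le_max_left _ _
    have h2 : ‖x.2‖ ≤ ‖Θ x‖ := le_max_right _ _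
    have h0 := norm_nonneg x.2
    rw [one_mul, Prod.norm_def]
    refine max_le ?_ (by nlinarith)
    have h3 := le_of_abs_le h1
    rw [Real.norm_eq_abs]
    have h4 : |x.1| ≤ 1 + x.1 ^ 2 := by rw [← sq_abs]; nlinarith [sq_nonneg (|x.1| - 1), abs_nonneg x.1]
    nlinarith
  refine ⟨smulLeftCLM ℂ (fun p : ℝ × E => p.1) (compCLM ℝ hΘ hup φ), fun w σ hw => ?_⟩
  have hs : 0 ≤ w ^ 2 - ‖σ‖ ^ 2 := by
    rw [← sq_abs w]
    nlinarith [norm_nonneg σ]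
  rw [smulLeftCLM_apply_apply hfst]
  simp only [Complex.real_smul]
  rw [← hP0, ← hφ _ _ hs]
  rfl

end Aux10

end Aux10Section

theorem stmt10 (ψ : SchwartzMap (ℝ × EuclideanSpace ℝ (Fin 2)) ℂ)
    (hψeven : ∀ (ω : ℝ) (σ : EuclideanSpace ℝ (Fin 2)), ψ (-ω, σ) = ψ (ω, σ)) :
    ∃ g : SchwartzMap (ℝ × EuclideanSpace ℝ (Fin 2)) ℂ,
      ∀ (ω : ℝ) (σ : EuclideanSpace ℝ (Fin 2)), ‖σ‖ ≤ |ω| →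
        g (ω, σ) = (ω : ℂ) * ψ (Real.sqrt (ω ^ 2 - ‖σ‖ ^ 2), σ) := by
  exact Aux10.final ψ hψeven
end

section
/- There exists a continuous linear map E₂ from the Schwartz space 𝒮(ℝ×ℝ², ℂ) to itself such that for every ψ ∈ 𝒮(ℝ×ℝ², ℂ) satisfying ψ(−ω,σ) = ψ(ω,σ) for all (ω,σ), one has (E₂ψ)(ω,σ) = ω · ψ(√ω, σ) for every ω ≥ 0 and σ ∈ ℝ². -/
open Real

namespace Ext12

section Helpers

open scoped ContDiff


lemma exists_C : ∃ C : ℝ → ℝ, ContDiff ℝ ∞ C ∧ ∀ x, C (x ^ 2) = Real.cos x := by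
  set c : ℕ → ℝ := fun n => (-1) ^ n / (2 * n).factorial with hc
  have hne : ∀ n, c n ≠ 0 := fun n => by simp only [hc]; positivity
  have hr : (FormalMultilinearSeries.ofScalars ℝ c).radius = ⊤ := by
    apply FormalMultilinearSeries.ofScalars_radius_eq_top_of_tendsto
    · exact Filter.Eventually.of_forall hne
    · have h : ∀ n : ℕ, ‖c n.succ‖ / ‖c n‖ = 1 / (((2 * n + 2 : ℕ) : ℝ) * ((2 * n + 1 : ℕ) : ℝ)) := by
        intro n
        have e : (2 * n.succ).factorial = (2 * n + 2) * ((2 * n + 1) * (2 * n).factorial) := by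
          rw [show 2 * n.succ = 2 * n + 1 + 1 by simp [Nat.succ_eq_add_one]; ring,
            Nat.factorial_succ, Nat.factorial_succ]
        simp only [hc, norm_div, norm_pow, norm_neg, norm_one, one_pow, e, Nat.cast_mul,
          norm_mul, RCLike.norm_natCast]
        have : ((2 * n).factorial : ℝ) ≠ 0 := by positivity
        field_simp
      simp_rw [h]
      apply squeeze_zero (g := fun n : ℕ => 1 / ((n : ℝ) + 1)) (fun n => by positivity) _
        tendsto_one_div_add_atTop_nhds_zero_nat
      intro n
      apply one_div_le_one_div_of_le (by positivity)
      push_cast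
      nlinarith [(Nat.cast_nonneg n : (0:ℝ) ≤ n)]
  have hp := (FormalMultilinearSeries.ofScalars ℝ c).hasFPowerSeriesOnBall (by rw [hr]; simp)
  rw [hr] at hp
  refine ⟨(FormalMultilinearSeries.ofScalars ℝ c).sum, ?_, ?_⟩
  · have : AnalyticOnNhd ℝ (FormalMultilinearSeries.ofScalars ℝ c).sum Set.univ := by
      have := hp.analyticOnNhd
      simpa using this
    exact (contDiffOn_univ.1 (this.contDiffOn (n := ω) uniqueDiffOn_univ)).of_le le_top
  · intro x
    change FormalMultilinearSeries.ofScalarsSum c (x ^ 2) = _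
    rw [FormalMultilinearSeries.ofScalars_sum_eq]
    rw [← (Real.hasSum_cos x).tsum_eq]
    congr 1; ext n
    simp [hc, ← pow_mul]; ring

lemma hasDerivAt_iter {C : ℝ → ℝ} (hC : ContDiff ℝ ∞ C) (n : ℕ) (z : ℝ) :
    HasDerivAt (iteratedDeriv n C) (iteratedDeriv (n + 1) C z) z := by
  rw [iteratedDeriv_succ]
  exact ((hC.differentiable_iteratedDeriv n (by exact_mod_cast WithTop.coe_lt_top _)) z).hasDerivAt

lemma C_bdd {C : ℝ → ℝ} (hC : ContDiff ℝ ∞ C) (hcos : ∀ x, C (x ^ 2) = Real.cos x) (n : ℕ) :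
    ∃ B, ∀ z, 1 ≤ z → |iteratedDeriv n C z| ≤ B := by
  have h0 : ∀ x, iteratedDeriv 0 C (x ^ 2) = Real.cos x := by simpa using hcos
  have h1 : ∀ x, 2 * x * iteratedDeriv 1 C (x ^ 2) = - Real.sin x := by
    intro x
    have a := (hasDerivAt_iter hC 0 (x ^ 2)).comp x (hasDerivAt_pow 2 x)
    have e : (iteratedDeriv 0 C ∘ fun x => x ^ 2) = Real.cos := by ext; simp [hcos]
    rw [e] at a
    have := a.unique (Real.hasDerivAt_cos x)
    rw [← this]; simp; ring
  have h2 : ∀ x, 2 * iteratedDeriv 1 C (x ^ 2) + 4 * x ^ 2 * iteratedDeriv 2 C (x ^ 2)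
      = - Real.cos x := by
    intro x
    have a := ((hasDerivAt_id x).const_mul 2).mul
      ((hasDerivAt_iter hC 1 (x ^ 2)).comp x (hasDerivAt_pow 2 x))
    have e : ((fun y => 2 * id y) * (iteratedDeriv 1 C ∘ fun x => x ^ 2))
        = fun x => - Real.sin x := by
      ext y; simpa using h1 y
    rw [e] at a
    have := a.unique (Real.hasDerivAt_sin x).neg
    rw [← this]; simp; ring
  have ode : ∀ n : ℕ, ∀ z, 0 < z → 4 * z * iteratedDeriv (n + 2) C z
      + (4 * n + 2) * iteratedDeriv (n + 1) C z + iteratedDeriv n C z = 0 := by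
    intro n
    induction n with
    | zero =>
      intro z hz
      have a := h2 (√z)
      have b := h0 (√z)
      rw [Real.sq_sqrt hz.le] at a b
      rw [← b] at a
      push_cast; linarith
    | succ n ih =>
      intro z hz
      have a := ((((hasDerivAt_id z).const_mul 4).mul (hasDerivAt_iter hC (n + 2) z)).add
        ((hasDerivAt_iter hC (n + 1) z).const_mul (4 * n + 2 : ℝ))).add (hasDerivAt_iter hC n z)
      have b : HasDerivAt (fun _ : ℝ => (0 : ℝ)) 0 z := hasDerivAt_const _ _
      have b' := b.congr_of_eventuallyEq (f₁ := fun z => 4 * z * iteratedDeriv (n + 2) C z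
      + (4 * n + 2) * iteratedDeriv (n + 1) C z + iteratedDeriv n C z)
        ((eventually_gt_nhds hz).mono fun y hy => ih y hy)
      have := a.unique b'
      push_cast
      simp at this
      rw [show n + 1 + 2 = n + 2 + 1 by ring, show n + 1 + 1 = n + 2 by ring]
      linarith
  have key : (∃ B, ∀ z, 1 ≤ z → |iteratedDeriv n C z| ≤ B) ∧
      (∃ B, ∀ z, 1 ≤ z → |iteratedDeriv (n + 1) C z| ≤ B) := by
    induction n with
    | zero =>
      constructor
      · refine ⟨1, fun z hz => ?_⟩
        have b := h0 (√z)
        rw [Real.sq_sqrt (by linarith)] at b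
        rw [b]; exact Real.abs_cos_le_one _
      · refine ⟨1, fun z hz => ?_⟩
        have b := h1 (√z)
        rw [Real.sq_sqrt (by linarith)] at b
        have hzz : 1 ≤ √z := by rw [Real.one_le_sqrt]; exact hz
        have : 2 * √z * |iteratedDeriv 1 C z| ≤ 1 := by
          rw [← abs_of_pos (show 0 < 2 * √z by positivity), ← abs_mul, b, abs_neg]
          exact Real.abs_sin_le_one _
        nlinarith [abs_nonneg (iteratedDeriv 1 C z)]
    | succ n ih =>
      refine ⟨ih.2, ?_⟩
      obtain ⟨⟨B0, hB0⟩, ⟨B1, hB1⟩⟩ := ih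
      refine ⟨(4 * n + 2) * B1 + B0, fun z hz => ?_⟩
      have e := ode n z (by linarith)
      have e' : 4 * z * iteratedDeriv (n + 2) C z =
        -((4 * n + 2) * iteratedDeriv (n + 1) C z) + - iteratedDeriv n C z := by linarith
      have : 4 * z * |iteratedDeriv (n + 2) C z| ≤ (4 * n + 2) * B1 + B0 := by
        rw [← abs_of_pos (show 0 < 4 * z by positivity), ← abs_mul, e']
        refine (abs_add_le _ _).trans ?_
        rw [abs_neg, abs_neg, abs_mul, abs_of_nonneg (show (0:ℝ) ≤ 4 * n + 2 by positivity)]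
        have := hB0 z hz
        have := hB1 z hz
        gcongr
      rw [show n + 1 + 1 = n + 2 by ring]
      nlinarith [abs_nonneg (iteratedDeriv (n + 2) C z)]
  exact key.1

lemma iter_congr {f g : ℝ → ℝ} {z : ℝ} (h : f =ᶠ[nhds z] g) (n : ℕ) :
    iteratedDeriv n f z = iteratedDeriv n g z := h.iteratedDeriv_eq n

lemma bdd_of {H : ℝ → ℝ} (hH : ContDiff ℝ ∞ H) (h0 : ∀ z, z ≤ -1 → H z = 0) (n : ℕ)
    (h1 : ∃ B, ∀ z, 1 < z → |iteratedDeriv n H z| ≤ B) :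
    ∃ B, ∀ z, |iteratedDeriv n H z| ≤ B := by
  obtain ⟨B, hB⟩ := h1
  have hcont : Continuous (iteratedDeriv n H) := hH.continuous_iteratedDeriv n (by exact_mod_cast le_top)
  obtain ⟨B', hB'⟩ := (isCompact_Icc (a := (-1 : ℝ)) (b := 1)).exists_bound_of_continuousOn
    hcont.continuousOn
  refine ⟨max B (max B' 0), fun z => ?_⟩
  rcases lt_or_ge z (-1) with h | h
  · have : H =ᶠ[nhds z] fun _ => (0 : ℝ) := (eventually_lt_nhds h).mono fun y hy => h0 y hy.le
    rw [iter_congr this]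
    simp
  · rcases le_or_gt z 1 with h' | h'
    · exact (hB' z ⟨h, h'⟩).trans (by simp)
    · exact (hB z h').trans (by simp)

lemma exists_chi : ∃ χ : ℝ → ℝ, ContDiff ℝ ∞ χ ∧ (∀ z, 0 ≤ z → χ z = 1) ∧
    (∀ z, z ≤ -1 → χ z = 0) ∧ ∀ n, ∃ B, ∀ z, |iteratedDeriv n χ z| ≤ B := by
  have hs : ContDiff ℝ ∞ (fun z : ℝ => Real.smoothTransition (z + 1)) :=
    Real.smoothTransition.contDiff.comp (contDiff_id.add contDiff_const)
  have h1 : ∀ z : ℝ, 0 ≤ z → Real.smoothTransition (z + 1) = 1 := fun z hz =>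
    Real.smoothTransition.one_of_one_le (by linarith)
  have h0 : ∀ z : ℝ, z ≤ -1 → Real.smoothTransition (z + 1) = 0 := fun z hz =>
    Real.smoothTransition.zero_of_nonpos (by linarith)
  refine ⟨_, hs, h1, h0, fun n => bdd_of hs h0 n ⟨1, fun z hz => ?_⟩⟩
  have : (fun z : ℝ => Real.smoothTransition (z + 1)) =ᶠ[nhds z] fun _ => (1 : ℝ) :=
    (eventually_gt_nhds hz).mono fun y hy => h1 y (by linarith)
  rw [iter_congr this, iteratedDeriv_const]
  split_ifs <;> simp

lemma exists_G : ∃ G : ℝ → ℝ, ContDiff ℝ ∞ G ∧ (∀ x, G (x ^ 2) = Real.cos x) ∧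
    ∀ n, ∃ B, ∀ z, |iteratedDeriv n G z| ≤ B := by
  obtain ⟨C, hC, hcos⟩ := exists_C
  obtain ⟨χ, hχ, h1, h0, -⟩ := exists_chi
  refine ⟨fun z => χ z * C z, hχ.mul hC, fun x => by simp only [h1 (x ^ 2) (by positivity), hcos, one_mul],
    fun n => bdd_of (hχ.mul hC) (fun z hz => by simp [h0 z hz]) n ?_⟩
  obtain ⟨B, hB⟩ := C_bdd hC hcos n
  refine ⟨B, fun z hz => ?_⟩
  have : (fun z => χ z * C z) =ᶠ[nhds z] C :=
    (eventually_gt_nhds hz).mono fun y hy => by simp [h1 y (by linarith)]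
  rw [iter_congr this]
  exact hB z hz.le


abbrev V := EuclideanSpace ℝ (Fin 2)
abbrev X := ℝ × V
abbrev S := SchwartzMap X ℂ

noncomputable section

/-- directional derivative -/
def pd (m : X) : S →L[ℂ] S :=
  (SchwartzMap.evalCLM ℂ X ℂ m).comp (SchwartzMap.fderivCLM ℂ X ℂ)

lemma pd_apply (m : X) (ψ : S) (x : X) : pd m ψ x = fderiv ℝ ψ x m := rfl

def eT : X := (1, 0)
def eS (j : Fin 2) : X := (0, EuclideanSpace.single j 1)

/-- minus the second derivative in the first variable -/
def Dl : S →L[ℂ] S := -((pd eT).comp (pd eT))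

lemma Dl_apply (ψ : S) : Dl ψ = - pd eT (pd eT ψ) := rfl

lemma pd_comm (m m' : X) (ψ : S) : pd m (pd m' ψ) = pd m' (pd m ψ) := by
  ext x
  have hs : IsSymmSndFDerivAt ℝ ψ x := by
    apply (ψ.smooth 2).contDiffAt.isSymmSndFDerivAt
    simp
  have h : ∀ a b : X, pd a (pd b ψ) x = fderiv ℝ (fderiv ℝ ψ) x a b := by
    intro a b
    rw [pd_apply]
    change fderiv ℝ (fun y => fderiv ℝ ψ y b) x a = _
    have hd : DifferentiableAt ℝ (fderiv ℝ ψ) x :=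
      (((ψ.smooth 2).fderiv_right (m := 1) (by norm_num)).differentiable (by norm_num)) x
    rw [fderiv_clm_apply hd (by fun_prop)]
    simp
  rw [h, h]
  exact hs m m'

lemma Dl_pd_comm (m : X) (ψ : S) : Dl (pd m ψ) = pd m (Dl ψ) := by
  rw [Dl_apply, Dl_apply, map_neg, pd_comm eT m ψ, pd_comm eT m]

lemma slice_growth (σ : V) : Function.HasTemperateGrowth (fun t : ℝ => ((t, σ) : X)) := by
  have h : (fun t : ℝ => ((t, σ) : X)) =
      (fun t => (ContinuousLinearMap.inl ℝ ℝ V) t) + fun _ => ((0, σ) : X) := by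
    ext t <;> simp
  rw [h]
  exact (ContinuousLinearMap.hasTemperateGrowth _).add (Function.HasTemperateGrowth.const _)

def slice (σ : V) : S →L[ℂ] SchwartzMap ℝ ℂ :=
  SchwartzMap.compCLM ℂ (slice_growth σ) ⟨1, 1, fun t => by
    have : ‖t‖ ≤ ‖((t, σ) : X)‖ := norm_fst_le ((t, σ) : X)
    simp only [pow_one, one_mul]; linarith⟩

lemma slice_apply (σ : V) (ψ : S) (t : ℝ) : slice σ ψ t = ψ (t, σ) := rfl

open FourierTransform

def N (ψ : S) (ξ : ℝ) (σ : V) : ℂ := 𝓕 (slice σ ψ : ℝ → ℂ) ξ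

lemma N_eq (ψ : S) (ξ : ℝ) (σ : V) :
    N ψ ξ σ = ∫ t : ℝ, (Real.fourierChar (-(t * ξ)) : ℂ) * ψ (t, σ) := by
  rw [N, Real.fourier_real_eq]
  rfl

lemma N_cont (ψ : S) (σ : V) : Continuous (fun ξ => N ψ ξ σ) := by
  have := (𝓕 (slice σ ψ)).continuous
  exact this

lemma N_add (ψ φ : S) (ξ : ℝ) (σ : V) : N (ψ + φ) ξ σ = N ψ ξ σ + N φ ξ σ := by
  have : 𝓕 (slice σ (ψ + φ)) = 𝓕 (slice σ ψ) + 𝓕 (slice σ φ) := by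
    rw [map_add, FourierTransform.fourier_add]
  exact congrArg (fun f : SchwartzMap ℝ ℂ => f ξ) this

lemma N_smul (c : ℂ) (ψ : S) (ξ : ℝ) (σ : V) : N (c • ψ) ξ σ = c * N ψ ξ σ := by
  have : 𝓕 (slice σ (c • ψ)) = c • 𝓕 (slice σ ψ) := by
    rw [map_smul, FourierTransform.fourier_smul]
  exact congrArg (fun f : SchwartzMap ℝ ℂ => f ξ) this

lemma slice_pd (σ : V) (ψ : S) : (slice σ (pd eT ψ) : ℝ → ℂ) = deriv (slice σ ψ) := by
  ext t
  have h1 : HasDerivAt (fun t : ℝ => ((t, σ) : X)) eT t := by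
    exact (hasDerivAt_id t).prodMk (hasDerivAt_const t σ)
  have h2 := (ψ.hasFDerivAt (t, σ)).comp_hasDerivAt t h1
  exact h2.deriv.symm

lemma N_pd (ψ : S) (ξ : ℝ) (σ : V) : N (pd eT ψ) ξ σ = (2 * π * Complex.I * ξ) * N ψ ξ σ := by
  rw [N, slice_pd, Real.fourier_deriv (slice σ ψ).integrable (slice σ ψ).differentiable]
  · rfl
  · rw [← slice_pd]; exact (slice σ (pd eT ψ)).integrable

lemma N_Dl (ψ : S) (ξ : ℝ) (σ : V) : N (Dl ψ) ξ σ = ((4 * π ^ 2 * ξ ^ 2 : ℝ) : ℂ) * N ψ ξ σ := by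
  rw [Dl_apply, ← neg_one_smul ℂ, N_smul, N_pd, N_pd]
  push_cast
  linear_combination (-4 * π ^ 2 * ξ ^ 2 * N ψ ξ σ : ℂ) * Complex.I_sq

/-! ### seminorm helpers -/

lemma q_scale (q : Seminorm ℂ S) (hq : Continuous q) (c : ℝ) (hc : 0 ≤ c) :
    ∃ q' : Seminorm ℂ S, Continuous q' ∧ ∀ ψ, q' ψ = c * q ψ :=
  by
  have e : ∀ ψ, (c.toNNReal • q) ψ = c * q ψ := by
    intro ψ
    rw [smul_apply, NNReal.smul_def, Real.coe_toNNReal c hc, smul_eq_mul]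
  refine ⟨c.toNNReal • q, ?_, e⟩
  have : ⇑(c.toNNReal • q) = fun ψ => c * q ψ := funext e
  rw [this]; fun_prop

lemma q_add (p q : Seminorm ℂ S) (hp : Continuous p) (hq : Continuous q) :
    Continuous (p + q : Seminorm ℂ S) := by
  have : ⇑(p + q) = fun ψ => p ψ + q ψ := by ext; rfl
  rw [this]; fun_prop

lemma q_comp (q : Seminorm ℂ S) (hq : Continuous q) (T : S →L[ℂ] S) :
    ∃ q' : Seminorm ℂ S, Continuous q' ∧ ∀ ψ, q' ψ = q (T ψ) :=
  ⟨q.comp (T : S →ₗ[ℂ] S), hq.comp T.continuous, fun _ => rfl⟩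

lemma q_sem (k n : ℕ) : Continuous (SchwartzMap.seminorm ℂ k n : Seminorm ℂ S) :=
  (schwartz_withSeminorms ℂ X ℂ).continuous_seminorm (k, n)

lemma base_bound (k : ℕ) : ∃ q : Seminorm ℂ S, Continuous q ∧
    ∀ ψ t σ, ‖σ‖ ^ k * ‖ψ (t, σ)‖ ≤ q ψ * (1 + t ^ 2)⁻¹ := by
  refine ⟨_, q_add _ _ (q_sem k 0) (q_sem (k + 2) 0), fun ψ t σ => ?_⟩
  rw [← div_eq_mul_inv, le_div_iff₀ (by positivity)]
  have h1 := SchwartzMap.norm_pow_mul_le_seminorm ℂ ψ k (t, σ)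
  have h2 := SchwartzMap.norm_pow_mul_le_seminorm ℂ ψ (k + 2) (t, σ)
  have ht : ‖t‖ ≤ ‖((t, σ) : X)‖ := norm_fst_le ((t, σ) : X)
  have hs : ‖σ‖ ≤ ‖((t, σ) : X)‖ := norm_snd_le ((t, σ) : X)
  have e : t ^ 2 = ‖t‖ ^ 2 := by simp
  calc ‖σ‖ ^ k * ‖ψ (t, σ)‖ * (1 + t ^ 2)
      = ‖σ‖ ^ k * ‖ψ (t, σ)‖ + ‖σ‖ ^ k * ‖t‖ ^ 2 * ‖ψ (t, σ)‖ := by rw [e]; ring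
    _ ≤ ‖((t, σ) : X)‖ ^ k * ‖ψ (t, σ)‖
        + ‖((t, σ) : X)‖ ^ k * ‖((t, σ) : X)‖ ^ 2 * ‖ψ (t, σ)‖ := by gcongr
    _ ≤ _ := by
      rw [← pow_add]
      exact add_le_add h1 h2

lemma N_bound0 (k : ℕ) : ∃ q : Seminorm ℂ S, Continuous q ∧
    ∀ ψ ξ σ, ‖σ‖ ^ k * ‖N ψ ξ σ‖ ≤ q ψ := by
  obtain ⟨q, hq, h⟩ := base_bound k
  obtain ⟨q', hq', h'⟩ := q_scale q hq (∫ t : ℝ, (1 + t ^ 2)⁻¹)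
    (MeasureTheory.integral_nonneg fun t => by positivity)
  refine ⟨q', hq', fun ψ ξ σ => ?_⟩
  rw [h', N_eq, ← abs_of_nonneg (show 0 ≤ ‖σ‖ ^ k by positivity), ← Real.norm_eq_abs, ← norm_smul,
    ← MeasureTheory.integral_smul, ← MeasureTheory.integral_mul_const]
  apply MeasureTheory.norm_integral_le_of_norm_le
  · exact integrable_inv_one_add_sq.mul_const _
  · refine Filter.Eventually.of_forall fun t => ?_
    rw [norm_smul, norm_mul, Circle.norm_coe, one_mul, norm_pow, norm_norm, mul_comm _ (q ψ)]
    exact h ψ t σ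

lemma N_bound (k : ℕ) : ∃ q : Seminorm ℂ S, Continuous q ∧
    ∀ ψ ξ σ, ‖σ‖ ^ k * ‖N ψ ξ σ‖ ≤ q ψ * (1 + ξ ^ 2)⁻¹ := by
  obtain ⟨q, hq, h⟩ := N_bound0 k
  obtain ⟨q', hq', h'⟩ := q_comp q hq Dl
  refine ⟨q + q', q_add _ _ hq hq', fun ψ ξ σ => ?_⟩
  rw [← div_eq_mul_inv, le_div_iff₀ (by positivity)]
  have h1 := h ψ ξ σ
  have h2 := h (Dl ψ) ξ σ
  rw [← h', N_Dl, norm_mul, Complex.norm_real, Real.norm_of_nonneg (by positivity)] at h2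
  have : ξ ^ 2 ≤ 4 * π ^ 2 * ξ ^ 2 := by
    have h4 : 1 ≤ 4 * π ^ 2 := by nlinarith [Real.pi_gt_three]
    exact le_mul_of_one_le_left (sq_nonneg ξ) h4
  calc ‖σ‖ ^ k * ‖N ψ ξ σ‖ * (1 + ξ ^ 2)
      = ‖σ‖ ^ k * ‖N ψ ξ σ‖ + ‖σ‖ ^ k * (ξ ^ 2 * ‖N ψ ξ σ‖) := by ring
    _ ≤ ‖σ‖ ^ k * ‖N ψ ξ σ‖ + ‖σ‖ ^ k * (4 * π ^ 2 * ξ ^ 2 * ‖N ψ ξ σ‖) := by gcongr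
    _ ≤ _ := add_le_add h1 h2

/-- the coordinate functionals -/
def prV (j : Fin 2) : V →L[ℝ] ℂ := Complex.ofRealCLM.comp (EuclideanSpace.proj j)

lemma fderiv_inr (ψ : S) (t : ℝ) (σ : V) :
    HasFDerivAt (fun σ : V => ψ (t, σ)) (∑ j, pd (eS j) ψ (t, σ) • prV j) σ := by
  have h1 : HasFDerivAt (fun σ : V => ((t, σ) : X)) (ContinuousLinearMap.inr ℝ ℝ V) σ :=
    hasFDerivAt_prodMk_right t σ
  have h2 := (ψ.hasFDerivAt (t, σ)).comp σ h1
  refine HasFDerivAt.congr_fderiv h2 ?_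
  ext v
  have hv : v = ∑ j, v j • (EuclideanSpace.single j (1 : ℝ) : V) := by
    ext i; fin_cases i <;> simp [Fin.sum_univ_two]
  have hv' : ((0, v) : X) = ∑ j, v j • eS j := by
    have := congrArg (ContinuousLinearMap.inr ℝ ℝ V) hv
    simpa [map_sum, eS] using this
  simp only [sum_apply, smul_apply,
    ContinuousLinearMap.comp_apply, ContinuousLinearMap.inr_apply]
  rw [hv', map_sum]
  refine Finset.sum_congr rfl fun j _ => ?_
  rw [map_smul, pd_apply]
  simp [prV, mul_comm]

lemma prV_norm (j : Fin 2) : ‖prV j‖ ≤ 1 := by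
  refine ContinuousLinearMap.opNorm_le_bound _ zero_le_one fun v => ?_
  simp only [prV, ContinuousLinearMap.comp_apply, Complex.ofRealCLM_apply, Complex.norm_real,
    one_mul]
  exact PiLp.norm_apply_le v j

lemma N_fderiv (ψ : S) (ξ : ℝ) (σ : V) :
    HasFDerivAt (fun σ : V => N ψ ξ σ) (∑ j, N (pd (eS j) ψ) ξ σ • prV j) σ := by
  obtain ⟨q, hq, h⟩ := base_bound 0
  have hInt : ∀ φ : S, ∀ σ, MeasureTheory.Integrable
      (fun t : ℝ => (Real.fourierChar (-(t * ξ)) : ℂ) * φ (t, σ)) := by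
    intro φ σ
    refine (MeasureTheory.Integrable.const_mul integrable_inv_one_add_sq (q φ)).mono' ?_ ?_
    · have : Continuous fun t : ℝ => (Real.fourierChar (-(t * ξ)) : ℂ) * φ (t, σ) := by
        have := φ.continuous
        have h3 : Continuous fun x : ℝ => (Real.fourierChar x : ℂ) :=
          continuous_subtype_val.comp Real.continuous_fourierChar
        fun_prop
      exact this.aestronglyMeasurable
    · refine Filter.Eventually.of_forall fun t => ?_
      rw [norm_mul, Circle.norm_coe]
      simpa using h φ t σ
  have hfun : (fun σ : V => N ψ ξ σ) =
      fun σ => ∫ t : ℝ, (Real.fourierChar (-(t * ξ)) : ℂ) * ψ (t, σ) := by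
    ext σ; exact N_eq ψ ξ σ
  have hder : (∑ j, N (pd (eS j) ψ) ξ σ • prV j) =
      ∫ t : ℝ, ∑ j, ((Real.fourierChar (-(t * ξ)) : ℂ) * pd (eS j) ψ (t, σ)) • prV j := by
    rw [MeasureTheory.integral_finsetSum]
    · refine Finset.sum_congr rfl fun j _ => ?_
      rw [integral_smul_const, N_eq]
    · exact fun j _ => (hInt _ σ).smul_const _
  rw [hfun, hder]
  apply hasFDerivAt_integral_of_dominated_of_fderiv_le (s := Set.univ)
    (bound := fun t => ∑ j, q (pd (eS j) ψ) * (1 + t ^ 2)⁻¹)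
    (F' := fun σ t => ∑ j, ((Real.fourierChar (-(t * ξ)) : ℂ) * pd (eS j) ψ (t, σ)) • prV j)
  · exact Filter.univ_mem
  · exact Filter.Eventually.of_forall fun σ => (hInt ψ σ).aestronglyMeasurable
  · exact hInt ψ σ
  · exact (MeasureTheory.integrable_finsetSum _
      fun j _ => (hInt (pd (eS j) ψ) σ).smul_const (prV j)).aestronglyMeasurable
  · refine Filter.Eventually.of_forall fun t σ _ => ?_
    refine norm_sum_le_of_le _ fun j _ => ?_
    rw [norm_smul, norm_mul, Circle.norm_coe, one_mul]
    have := h (pd (eS j) ψ) t σ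
    simp only [pow_zero, one_mul] at this
    exact (mul_le_of_le_one_right (norm_nonneg _) (prV_norm j)).trans this
  · exact MeasureTheory.integrable_finsetSum _
      fun j _ => MeasureTheory.Integrable.const_mul integrable_inv_one_add_sq _
  · refine Filter.Eventually.of_forall fun t σ _ => ?_
    have := (fderiv_inr ψ t σ).const_mul (Real.fourierChar (-(t * ξ)) : ℂ)
    refine this.congr_fderiv ?_
    rw [Finset.smul_sum]
    simp_rw [smul_smul]


/-! ### the integral operator -/

/-- the integral operator -/
def I (H : ℝ → ℝ) (ψ : S) (x : X) : ℂ :=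
  ∫ ξ : ℝ, N ψ ξ x.2 * (H (4 * π ^ 2 * ξ ^ 2 * x.1) : ℂ)

lemma I_bound (k : ℕ) (B : ℝ) : ∃ q : Seminorm ℂ S, Continuous q ∧
    ∀ H : ℝ → ℝ, (∀ z, |H z| ≤ B) → ∀ ψ x, ‖x.2‖ ^ k * ‖I H ψ x‖ ≤ q ψ := by
  obtain ⟨q, hq, h⟩ := N_bound k
  obtain ⟨q', hq', h'⟩ := q_scale q hq (|B| * ∫ t : ℝ, (1 + t ^ 2)⁻¹)
    (mul_nonneg (abs_nonneg _) (MeasureTheory.integral_nonneg fun t => by positivity))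
  refine ⟨q', hq', fun H hH ψ x => ?_⟩
  rw [h', I, ← abs_of_nonneg (show 0 ≤ ‖x.2‖ ^ k by positivity), ← Real.norm_eq_abs (‖x.2‖ ^ k),
    ← norm_smul, ← MeasureTheory.integral_smul, mul_assoc, ← MeasureTheory.integral_mul_const,
    ← MeasureTheory.integral_const_mul]
  apply MeasureTheory.norm_integral_le_of_norm_le
  · exact (integrable_inv_one_add_sq.mul_const _).const_mul _
  · refine Filter.Eventually.of_forall fun t => ?_
    rw [norm_smul, norm_mul, norm_pow, norm_norm, Complex.norm_real, Real.norm_eq_abs]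
    have h1 := h ψ t x.2
    have h2 := (hH (4 * π ^ 2 * t ^ 2 * x.1)).trans (le_abs_self B)
    calc ‖x.2‖ ^ k * (‖N ψ t x.2‖ * |H (4 * π ^ 2 * t ^ 2 * x.1)|)
        = (‖x.2‖ ^ k * ‖N ψ t x.2‖) * |H (4 * π ^ 2 * t ^ 2 * x.1)| := by ring
      _ ≤ (q ψ * (1 + t ^ 2)⁻¹) * |B| := by gcongr
      _ = _ := by ring

lemma I_int {H : ℝ → ℝ} (hc : Continuous H) {B : ℝ} (hB : ∀ z, |H z| ≤ B) (ψ : S) (x : X) :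
    MeasureTheory.Integrable (fun ξ : ℝ => N ψ ξ x.2 * (H (4 * π ^ 2 * ξ ^ 2 * x.1) : ℂ)) := by
  obtain ⟨q, hq, h⟩ := N_bound 0
  refine (MeasureTheory.Integrable.const_mul integrable_inv_one_add_sq (q ψ * |B|)).mono' ?_ ?_
  · have h1 := N_cont ψ x.2
    have : Continuous fun ξ : ℝ => N ψ ξ x.2 * (H (4 * π ^ 2 * ξ ^ 2 * x.1) : ℂ) := by
      fun_prop
    exact this.aestronglyMeasurable
  · refine Filter.Eventually.of_forall fun t => ?_
    rw [norm_mul, Complex.norm_real, Real.norm_eq_abs]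
    have h1 := h ψ t x.2
    rw [pow_zero, one_mul] at h1
    have h2 := (hB (4 * π ^ 2 * t ^ 2 * x.1)).trans (le_abs_self B)
    calc ‖N ψ t x.2‖ * |H (4 * π ^ 2 * t ^ 2 * x.1)|
        ≤ (q ψ * (1 + t ^ 2)⁻¹) * |B| := by gcongr
      _ = _ := by ring

lemma I_add {H : ℝ → ℝ} (hc : Continuous H) {B : ℝ} (hB : ∀ z, |H z| ≤ B) (ψ φ : S) (x : X) :
    I H (ψ + φ) x = I H ψ x + I H φ x := by
  rw [I, I, I, ← MeasureTheory.integral_add (I_int hc hB ψ x) (I_int hc hB φ x)]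
  congr 1; ext ξ; rw [N_add, add_mul]

lemma I_smul (H : ℝ → ℝ) (c : ℂ) (ψ : S) (x : X) :
    I H (c • ψ) x = c * I H ψ x := by
  rw [I, I, ← MeasureTheory.integral_const_mul]
  congr 1; ext ξ; rw [N_smul, mul_assoc]

/-- first coordinate functional -/
def L0 : X →L[ℝ] ℂ := Complex.ofRealCLM.comp (ContinuousLinearMap.fst ℝ ℝ V)
/-- other coordinate functionals -/
def L1 (j : Fin 2) : X →L[ℝ] ℂ := (prV j).comp (ContinuousLinearMap.snd ℝ ℝ V)

lemma L0_norm : ‖L0‖ ≤ 1 := by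
  refine ContinuousLinearMap.opNorm_le_bound _ zero_le_one fun v => ?_
  simp only [L0, ContinuousLinearMap.comp_apply, Complex.ofRealCLM_apply, Complex.norm_real,
    one_mul]
  exact norm_fst_le v

lemma L1_norm (j : Fin 2) : ‖L1 j‖ ≤ 1 := by
  refine ContinuousLinearMap.opNorm_le_bound _ zero_le_one fun v => ?_
  rw [L1, ContinuousLinearMap.comp_apply]
  refine ((prV j).le_of_opNorm_le (prV_norm j) _).trans ?_
  gcongr
  exact norm_snd_le v

lemma I_fderiv {H H' : ℝ → ℝ} (hd : ∀ z, HasDerivAt H (H' z) z) (hc' : Continuous H') {B B' : ℝ}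
    (hB : ∀ z, |H z| ≤ B) (hB' : ∀ z, |H' z| ≤ B') (ψ : S) (x : X) :
    HasFDerivAt (I H ψ) (I H' (Dl ψ) x • L0 + ∑ j, I H (pd (eS j) ψ) x • L1 j) x := by
  have hc : Continuous H := continuous_iff_continuousAt.2 fun z => (hd z).continuousAt
  obtain ⟨q, hq, h⟩ := N_bound 0
  have hder : (I H' (Dl ψ) x • L0 + ∑ j, I H (pd (eS j) ψ) x • L1 j) =
      ∫ ξ : ℝ, ((N (Dl ψ) ξ x.2 * (H' (4 * π ^ 2 * ξ ^ 2 * x.1) : ℂ)) • L0 +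
        ∑ j, (N (pd (eS j) ψ) ξ x.2 * (H (4 * π ^ 2 * ξ ^ 2 * x.1) : ℂ)) • L1 j) := by
    rw [MeasureTheory.integral_add, MeasureTheory.integral_finsetSum]
    · simp_rw [integral_smul_const]
      rfl
    · exact fun j _ => (I_int hc hB _ x).smul_const _
    · exact (I_int hc' hB' _ x).smul_const _
    · exact MeasureTheory.integrable_finsetSum _ fun j _ => (I_int hc hB _ x).smul_const _
  rw [hder]
  have hN : ∀ φ : S, ∀ ξ σ, ‖N φ ξ σ‖ ≤ q φ * (1 + ξ ^ 2)⁻¹ := by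
    intro φ ξ σ
    simpa using h φ ξ σ
  apply hasFDerivAt_integral_of_dominated_of_fderiv_le (s := Set.univ)
    (bound := fun ξ => q (Dl ψ) * (1 + ξ ^ 2)⁻¹ * |B'| +
      ∑ j, q (pd (eS j) ψ) * (1 + ξ ^ 2)⁻¹ * |B|)
    (F := fun x ξ => N ψ ξ x.2 * (H (4 * π ^ 2 * ξ ^ 2 * x.1) : ℂ))
    (F' := fun x ξ => ((N (Dl ψ) ξ x.2 * (H' (4 * π ^ 2 * ξ ^ 2 * x.1) : ℂ)) • L0 +
        ∑ j, (N (pd (eS j) ψ) ξ x.2 * (H (4 * π ^ 2 * ξ ^ 2 * x.1) : ℂ)) • L1 j))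
  · exact Filter.univ_mem
  · exact Filter.Eventually.of_forall fun x => (I_int hc hB ψ x).aestronglyMeasurable
  · exact I_int hc hB ψ x
  · exact (((I_int hc' hB' (Dl ψ) x).smul_const L0).add (MeasureTheory.integrable_finsetSum _
      fun j _ => (I_int hc hB (pd (eS j) ψ) x).smul_const (L1 j))).aestronglyMeasurable
  · refine Filter.Eventually.of_forall fun ξ x _ => ?_
    refine (norm_add_le _ _).trans (add_le_add ?_ (norm_sum_le_of_le _ fun j _ => ?_))
    · rw [norm_smul, norm_mul, Complex.norm_real, Real.norm_eq_abs]
      refine (mul_le_of_le_one_right (by positivity) L0_norm).trans ?_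
      exact mul_le_mul (hN _ _ _) ((hB' _).trans (le_abs_self _)) (abs_nonneg _)
        ((norm_nonneg _).trans (hN _ _ x.2))
    · rw [norm_smul, norm_mul, Complex.norm_real, Real.norm_eq_abs]
      refine (mul_le_of_le_one_right (by positivity) (L1_norm j)).trans ?_
      exact mul_le_mul (hN _ _ _) ((hB _).trans (le_abs_self _)) (abs_nonneg _)
        ((norm_nonneg _).trans (hN _ _ x.2))
  · refine ((MeasureTheory.Integrable.const_mul integrable_inv_one_add_sq _).mul_const _).add
      (MeasureTheory.integrable_finsetSum _
      fun j _ => (MeasureTheory.Integrable.const_mul integrable_inv_one_add_sq _).mul_const _)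
  · refine Filter.Eventually.of_forall fun ξ x _ => ?_
    have h1 : HasFDerivAt (fun x : X => N ψ ξ x.2) _ x :=
      (N_fderiv ψ ξ x.2).comp x (hasFDerivAt_snd (𝕜 := ℝ))
    have h2 : HasDerivAt (fun t : ℝ => (H (4 * π ^ 2 * ξ ^ 2 * t) : ℂ))
        ((H' (4 * π ^ 2 * ξ ^ 2 * x.1) * (4 * π ^ 2 * ξ ^ 2) : ℝ) : ℂ) x.1 := by
      have h3 := (hd (4 * π ^ 2 * ξ ^ 2 * x.1)).comp x.1
        ((hasDerivAt_id x.1).const_mul (4 * π ^ 2 * ξ ^ 2))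
      have h4 := h3.ofReal_comp
      simpa using h4
    have h3 : HasFDerivAt (fun x : X => (H (4 * π ^ 2 * ξ ^ 2 * x.1) : ℂ)) _ x :=
      h2.hasFDerivAt.comp x (hasFDerivAt_fst (𝕜 := ℝ))
    refine (h1.mul h3).congr_fderiv ?_
    ext v
    all_goals
      simp [N_Dl, L0, L1]
      try ring

lemma inversion (ψ : S) (t : ℝ) (σ : V) :
    ψ (t, σ) = ∫ ξ : ℝ, (Real.fourierChar (ξ * t) : ℂ) * N ψ ξ σ := by
  have h : 𝓕⁻ (𝓕 (slice σ ψ)) = slice σ ψ := FourierTransform.fourierInv_fourier_eq _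
  have h2 := congrArg (fun f : SchwartzMap ℝ ℂ => f t) h
  rw [← slice_apply, ← h2]
  change (𝓕⁻ (𝓕 (slice σ ψ))) t = _
  rw [SchwartzMap.fourierInv_coe, Real.fourierInv_eq]
  congr 1
  ext ξ
  simp [N, Circle.smul_def, SchwartzMap.fourier_coe, mul_comm]

lemma I_eval {G : ℝ → ℝ} (hG : ∀ x, G (x ^ 2) = cos x) (ψ : S)
    (w : ℝ) (hw : 0 ≤ w) (σ : V) :
    I G ψ (w, σ) = (ψ (√w, σ) + ψ (-√w, σ)) / 2 := by
  have hInt : ∀ t : ℝ, MeasureTheory.Integrable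
      fun ξ : ℝ => (Real.fourierChar (ξ * t) : ℂ) * N ψ ξ σ := by
    intro t
    have h1 : MeasureTheory.Integrable (fun ξ => N ψ ξ σ) := (𝓕 (slice σ ψ)).integrable
    refine h1.mono ?_ ?_
    · have h2 := N_cont ψ σ
      have h3 : Continuous fun x : ℝ => (Real.fourierChar x : ℂ) :=
          continuous_subtype_val.comp Real.continuous_fourierChar
      have : Continuous fun ξ : ℝ => (Real.fourierChar (ξ * t) : ℂ) * N ψ ξ σ := by fun_prop
      exact this.aestronglyMeasurable
    · refine Filter.Eventually.of_forall fun t => ?_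
      rw [norm_mul, Circle.norm_coe, one_mul]
  rw [inversion ψ (√w) σ, inversion ψ (-√w) σ, ← MeasureTheory.integral_add (hInt _) (hInt _),
    I, ← MeasureTheory.integral_div]
  congr 1
  ext ξ
  have e : 4 * π ^ 2 * ξ ^ 2 * w = (2 * π * (ξ * √w)) ^ 2 := by
    rw [mul_pow, mul_pow, mul_pow, Real.sq_sqrt hw]; ring
  simp only [e, hG, Real.fourierChar_apply, Complex.ofReal_cos, Complex.cos]
  push_cast
  rw [show (2 * π * (ξ * -(√w : ℂ)) * Complex.I : ℂ) = -(2 * π * (ξ * √w)) * Complex.I by ring]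
  ring


/-! ### the derivatives of the operator -/

/-- smooth with bounded derivatives -/
structure Good (G : ℝ → ℝ) : Prop where
  smooth : ContDiff ℝ ∞ G
  bdd : ∀ n, ∃ B, ∀ z, |iteratedDeriv n G z| ≤ B

lemma Good.cont {G : ℝ → ℝ} (hG : Good G) (n : ℕ) : Continuous (iteratedDeriv n G) :=
  continuous_iff_continuousAt.2 fun z => (hasDerivAt_iter hG.smooth n z).continuousAt

/-- iterated derivatives in the first variable -/
def F (G : ℝ → ℝ) (n : ℕ) (ψ : S) (x : X) : ℂ := I (iteratedDeriv n G) ((Dl ^ n) ψ) x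

lemma Dlpow_pd_comm (n : ℕ) (m : X) (ψ : S) : (Dl ^ n) (pd m ψ) = pd m ((Dl ^ n) ψ) := by
  induction n with
  | zero => rfl
  | succ n ih =>
    rw [pow_succ']
    change Dl ((Dl ^ n) (pd m ψ)) = pd m (Dl ((Dl ^ n) ψ))
    rw [ih, Dl_pd_comm]

lemma F_fderiv {G : ℝ → ℝ} (hG : Good G) (n : ℕ) (ψ : S) (x : X) :
    HasFDerivAt (F G n ψ) (F G (n + 1) ψ x • L0 + ∑ j, F G n (pd (eS j) ψ) x • L1 j) x := by
  obtain ⟨B, hB⟩ := hG.bdd n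
  obtain ⟨B', hB'⟩ := hG.bdd (n + 1)
  have h := I_fderiv (hasDerivAt_iter hG.smooth n) (hG.cont (n + 1)) hB hB' ((Dl ^ n) ψ) x
  have e : (Dl ^ (n + 1)) ψ = Dl ((Dl ^ n) ψ) := by rw [pow_succ']; rfl
  simp only [F, e, Dlpow_pd_comm]
  exact h

lemma F_add {G : ℝ → ℝ} (hG : Good G) (n : ℕ) (ψ φ : S) (x : X) :
    F G n (ψ + φ) x = F G n ψ x + F G n φ x := by
  obtain ⟨B, hB⟩ := hG.bdd n
  rw [F, map_add, I_add (hG.cont n) hB]; rfl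

lemma F_smul (G : ℝ → ℝ) (n : ℕ) (c : ℂ) (ψ : S) (x : X) :
    F G n (c • ψ) x = c * F G n ψ x := by
  rw [F, map_smul, I_smul]; rfl

lemma F_bound {G : ℝ → ℝ} (hG : Good G) (n k : ℕ) : ∃ q : Seminorm ℂ S, Continuous q ∧
    ∀ ψ x, ‖x.2‖ ^ k * ‖F G n ψ x‖ ≤ q ψ := by
  obtain ⟨B, hB⟩ := hG.bdd n
  obtain ⟨q, hq, h⟩ := I_bound k B
  obtain ⟨q', hq', h'⟩ := q_comp q hq (Dl ^ n)
  exact ⟨q', hq', fun ψ x => by rw [h']; exact h _ hB _ _⟩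

lemma F_deriv {G : ℝ → ℝ} (hG : Good G) (n : ℕ) (ψ : S) (w : ℝ) (σ : V) :
    HasDerivAt (fun w : ℝ => F G n ψ (w, σ)) (F G (n + 1) ψ (w, σ)) w := by
  have h1 : HasDerivAt (fun t : ℝ => ((t, σ) : X)) eT w :=
    (hasDerivAt_id w).prodMk (hasDerivAt_const w σ)
  have h2 := (F_fderiv hG n ψ (w, σ)).comp_hasDerivAt w h1
  have e : (F G (n + 1) ψ (w, σ) • L0 + ∑ j, F G n (pd (eS j) ψ) (w, σ) • L1 j) eT
      = F G (n + 1) ψ (w, σ) := by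
    simp [L0, L1, eT]
  rw [e] at h2
  exact h2

lemma growth_sq : Function.HasTemperateGrowth (fun x : X => L0 x * L0 x) :=
  L0.hasTemperateGrowth.mul L0.hasTemperateGrowth

/-- multiplication by the square of the first variable -/
def M : S →L[ℂ] S := SchwartzMap.smulLeftCLM ℂ (fun x : X => L0 x * L0 x)

lemma M_apply (ψ : S) (t : ℝ) (σ : V) : M ψ (t, σ) = (t : ℂ) * t * ψ (t, σ) := by
  rw [M, SchwartzMap.smulLeftCLM_apply_apply growth_sq]
  rfl

lemma F_M {G : ℝ → ℝ} (hG : Good G) (hcos : ∀ x, G (x ^ 2) = cos x) (ψ : S) (σ : V) (n : ℕ) :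
    ∀ w : ℝ, 0 < w → F G n (M ψ) (w, σ) = w * F G n ψ (w, σ) + n * F G (n - 1) ψ (w, σ) := by
  induction n with
  | zero =>
    intro w hw
    simp only [F, pow_zero, iteratedDeriv_zero]
    change I G (M ψ) (w, σ) = w * I G ψ (w, σ) + _
    rw [I_eval hcos _ _ hw.le, I_eval hcos _ _ hw.le, M_apply, M_apply]
    have : (√w : ℂ) * √w = w := by
      rw [← Complex.ofReal_mul, Real.mul_self_sqrt hw.le]
    push_cast
    rw [neg_mul_neg, this]
    ring
  | succ n ih =>
    intro w hw
    have h1 := F_deriv hG n (M ψ) w σ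
    have h2 : HasDerivAt (fun w : ℝ => (w : ℂ) * F G n ψ (w, σ) + n * F G (n - 1) ψ (w, σ))
        (1 * F G n ψ (w, σ) + w * F G (n + 1) ψ (w, σ) + n * F G (n - 1 + 1) ψ (w, σ)) w :=
      ((hasDerivAt_id w).ofReal_comp.mul (F_deriv hG n ψ w σ)).add
        ((F_deriv hG (n - 1) ψ w σ).const_mul (n : ℂ))
    have h3 : (fun w : ℝ => F G n (M ψ) (w, σ)) =ᶠ[nhds w]
        (fun w : ℝ => (w : ℂ) * F G n ψ (w, σ) + n * F G (n - 1) ψ (w, σ)) := by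
      filter_upwards [lt_mem_nhds hw] with v hv using ih v hv
    rw [h1.unique (h2.congr_of_eventuallyEq h3)]
    rcases n with _ | n
    · simp; ring
    · simp only [Nat.add_sub_cancel]; push_cast; ring

lemma F_decay {G : ℝ → ℝ} (hG : Good G) (hcos : ∀ x, G (x ^ 2) = cos x) (k : ℕ) :
    ∀ n, ∃ q : Seminorm ℂ S, Continuous q ∧
      ∀ ψ w σ, 0 < w → w ^ k * ‖F G n ψ (w, σ)‖ ≤ q ψ := by
  induction k with
  | zero =>
    intro n
    obtain ⟨q, hq, h⟩ := F_bound hG n 0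
    exact ⟨q, hq, fun ψ w σ _ => by simpa using h ψ (w, σ)⟩
  | succ k ih =>
    intro n
    obtain ⟨q, hq, h⟩ := ih n
    obtain ⟨p, hp, h2⟩ := ih (n - 1)
    obtain ⟨q', hq', h'⟩ := q_comp q hq M
    obtain ⟨p', hp', h2'⟩ := q_scale p hp n (Nat.cast_nonneg n)
    refine ⟨q' + p', q_add _ _ hq' hp', fun ψ w σ hw => ?_⟩
    have e : (w : ℂ) * F G n ψ (w, σ) = F G n (M ψ) (w, σ) - n * F G (n - 1) ψ (w, σ) := by
      rw [F_M hG hcos ψ σ n w hw]; ring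
    have e2 : w * ‖F G n ψ (w, σ)‖ = ‖(w : ℂ) * F G n ψ (w, σ)‖ := by
      rw [norm_mul, Complex.norm_real, Real.norm_of_nonneg hw.le]
    have e3 : ‖(n : ℂ) * F G (n - 1) ψ (w, σ)‖ = n * ‖F G (n - 1) ψ (w, σ)‖ := by
      rw [norm_mul, Complex.norm_natCast]
    calc w ^ (k + 1) * ‖F G n ψ (w, σ)‖ = w ^ k * (w * ‖F G n ψ (w, σ)‖) := by ring
      _ ≤ w ^ k * (‖F G n (M ψ) (w, σ)‖ + n * ‖F G (n - 1) ψ (w, σ)‖) := by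
          rw [e2, e, ← e3]; gcongr; exact norm_sub_le _ _
      _ = w ^ k * ‖F G n (M ψ) (w, σ)‖ + n * (w ^ k * ‖F G (n - 1) ψ (w, σ)‖) := by ring
      _ ≤ q (M ψ) + n * p ψ := by
          gcongr
          · exact h _ _ _ hw
          · exact h2 _ _ _ hw
      _ = (q' + p') ψ := by rw [add_apply, h', h2']

/-! ### the family with cutoff -/

/-- the family -/
def f (χ G : ℝ → ℝ) (i n : ℕ) (T : S →L[ℂ] S) (ψ : S) (x : X) : ℂ :=
  ((iteratedDeriv i χ x.1 : ℝ) : ℂ) * F G n (T ψ) x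

lemma f_fderiv {χ G : ℝ → ℝ} (hχ : Good χ) (hG : Good G) (i n : ℕ) (T : S →L[ℂ] S) (ψ : S)
    (x : X) : HasFDerivAt (f χ G i n T ψ)
      (f χ G (i + 1) n T ψ x • L0 + f χ G i (n + 1) T ψ x • L0 +
        (f χ G i n ((pd (eS 0)).comp T) ψ x • L1 0 +
          f χ G i n ((pd (eS 1)).comp T) ψ x • L1 1)) x := by
  have h2 : HasDerivAt (fun t : ℝ => ((iteratedDeriv i χ t : ℝ) : ℂ))
      ((iteratedDeriv (i + 1) χ x.1 : ℝ) : ℂ) x.1 := (hasDerivAt_iter hχ.smooth i x.1).ofReal_comp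
  have h3 : HasFDerivAt (fun x : X => ((iteratedDeriv i χ x.1 : ℝ) : ℂ)) _ x :=
    h2.hasFDerivAt.comp x (hasFDerivAt_fst (𝕜 := ℝ))
  refine (h3.mul (F_fderiv hG n (T ψ) x)).congr_fderiv ?_
  ext v
  all_goals
    simp [L0, L1, f, Fin.sum_univ_two]
    try ring

lemma f_contDiff {χ G : ℝ → ℝ} (hχ : Good χ) (hG : Good G) (m : ℕ) :
    ∀ (i n : ℕ) (T : S →L[ℂ] S) (ψ : S), ContDiff ℝ m (f χ G i n T ψ) := by
  induction m with
  | zero =>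
    intro i n T ψ
    refine contDiff_zero.2 (continuous_iff_continuousAt.2 fun x => ?_)
    exact (f_fderiv hχ hG i n T ψ x).continuousAt
  | succ m ih =>
    intro i n T ψ
    refine contDiff_succ_iff_hasFDerivAt.2 ⟨_, ?_, f_fderiv hχ hG i n T ψ⟩
    have := ih (i + 1) n T ψ
    have := ih i (n + 1) T ψ
    have := ih i n ((pd (eS 0)).comp T) ψ
    have := ih i n ((pd (eS 1)).comp T) ψ
    fun_prop

lemma f_bound0 {χ G : ℝ → ℝ} (hχ : Good χ) (h0 : ∀ z, z ≤ -1 → χ z = 0) (hG : Good G)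
    (hcos : ∀ x, G (x ^ 2) = cos x) (i n k : ℕ) (T : S →L[ℂ] S) :
    ∃ q : Seminorm ℂ S, Continuous q ∧ ∀ ψ x, ‖x‖ ^ k * ‖f χ G i n T ψ x‖ ≤ q ψ := by
  obtain ⟨q0, hq0, H0⟩ := F_bound hG n 0
  obtain ⟨q1, hq1, H1⟩ := F_bound hG n k
  obtain ⟨q2, hq2, H2⟩ := F_decay hG hcos k n
  obtain ⟨b, hb⟩ := hχ.bdd i
  have hb0 : 0 ≤ b := (abs_nonneg _).trans (hb 0)
  obtain ⟨q3, hq3, H3⟩ := q_scale _ (q_add _ _ (q_add _ _ hq0 hq1) hq2) b hb0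
  obtain ⟨q, hq, H⟩ := q_comp _ hq3 T
  refine ⟨q, hq, fun ψ x => ?_⟩
  rw [H, H3, add_apply, add_apply]
  have A0 := H0 (T ψ) x
  have A1 := H1 (T ψ) x
  rw [pow_zero, one_mul] at A0
  have P0 := apply_nonneg q0 (T ψ)
  have P1 := apply_nonneg q1 (T ψ)
  have P2 := apply_nonneg q2 (T ψ)
  rcases lt_or_ge x.1 (-1) with hx | hx
  · have e : χ =ᶠ[nhds x.1] fun _ => (0 : ℝ) := by
      filter_upwards [gt_mem_nhds hx] with v hv using h0 v (le_of_lt hv)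
    rw [f, iter_congr e]
    simp
    positivity
  have hk : |x.1| ^ k * ‖F G n (T ψ) x‖ ≤ q0 (T ψ) + q2 (T ψ) := by
    rcases le_or_gt x.1 1 with hx1 | hx1
    · have h1 : |x.1| ^ k ≤ 1 := pow_le_one₀ (abs_nonneg _) (abs_le.2 ⟨hx, hx1⟩)
      have := mul_le_of_le_one_left (norm_nonneg (F G n (T ψ) x)) h1
      linarith
    · have hp : 0 < x.1 := by linarith
      have := H2 (T ψ) x.1 x.2 hp
      rw [abs_of_pos hp]
      linarith
  have hn : ‖x‖ ^ k ≤ |x.1| ^ k + ‖x.2‖ ^ k := by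
    rw [Prod.norm_def, Real.norm_eq_abs]
    rcases max_cases |x.1| ‖x.2‖ with h | h <;> rw [h.1]
    · have : 0 ≤ ‖x.2‖ ^ k := by positivity
      linarith
    · have : 0 ≤ |x.1| ^ k := by positivity
      linarith
  rw [f, norm_mul, Complex.norm_real, Real.norm_eq_abs]
  calc ‖x‖ ^ k * (|iteratedDeriv i χ x.1| * ‖F G n (T ψ) x‖)
      ≤ (|x.1| ^ k + ‖x.2‖ ^ k) * (b * ‖F G n (T ψ) x‖) := by gcongr; exact hb _
    _ = b * (|x.1| ^ k * ‖F G n (T ψ) x‖ + ‖x.2‖ ^ k * ‖F G n (T ψ) x‖) := by ring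
    _ ≤ _ := mul_le_mul_of_nonneg_left (by linarith) hb0

lemma smul_bd (L : X →L[ℝ] ℂ) : ∃ C : ℝ, 0 ≤ C ∧ ∀ (m : ℕ) (a : X → ℂ), ContDiff ℝ m a →
    ∀ x, ‖iteratedFDeriv ℝ m (fun x => a x • L) x‖ ≤ C * ‖iteratedFDeriv ℝ m a x‖ := by
  refine ⟨‖(ContinuousLinearMap.toSpanSingleton ℂ L).restrictScalars ℝ‖,
    ContinuousLinearMap.opNorm_nonneg _, ?_⟩
  intro m a ha x
  exact ContinuousLinearMap.norm_iteratedFDeriv_comp_left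
    ((ContinuousLinearMap.toSpanSingleton ℂ L).restrictScalars ℝ) ha.contDiffAt le_rfl

lemma f_bound {χ G : ℝ → ℝ} (hχ : Good χ) (h0 : ∀ z, z ≤ -1 → χ z = 0) (hG : Good G)
    (hcos : ∀ x, G (x ^ 2) = cos x) (k m : ℕ) : ∀ (i n : ℕ) (T : S →L[ℂ] S),
    ∃ q : Seminorm ℂ S, Continuous q ∧
      ∀ ψ x, ‖x‖ ^ k * ‖iteratedFDeriv ℝ m (f χ G i n T ψ) x‖ ≤ q ψ := by
  induction m with
  | zero =>
    intro i n T
    obtain ⟨q, hq, h⟩ := f_bound0 hχ h0 hG hcos i n k T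
    exact ⟨q, hq, fun ψ x => by rw [norm_iteratedFDeriv_zero]; exact h ψ x⟩
  | succ m ih =>
    intro i n T
    have key : ∀ (i n : ℕ) (T : S →L[ℂ] S) (L : X →L[ℝ] ℂ), ∃ q : Seminorm ℂ S, Continuous q ∧
        ∀ ψ x, ‖x‖ ^ k * ‖iteratedFDeriv ℝ m (fun x => f χ G i n T ψ x • L) x‖ ≤ q ψ := by
      intro i n T L
      obtain ⟨C, hC, hL⟩ := smul_bd L
      obtain ⟨q, hq, h⟩ := ih i n T
      obtain ⟨q', hq', h'⟩ := q_scale q hq C hC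
      refine ⟨q', hq', fun ψ x => ?_⟩
      have h1 := hL m _ (f_contDiff hχ hG m i n T ψ) x
      have h2 := h ψ x
      rw [h']
      calc ‖x‖ ^ k * ‖iteratedFDeriv ℝ m (fun x => f χ G i n T ψ x • L) x‖
          ≤ ‖x‖ ^ k * (C * ‖iteratedFDeriv ℝ m (f χ G i n T ψ) x‖) := by gcongr
        _ = C * (‖x‖ ^ k * ‖iteratedFDeriv ℝ m (f χ G i n T ψ) x‖) := by ring
        _ ≤ _ := by gcongr
    obtain ⟨qa, hqa, Ha⟩ := key (i + 1) n T L0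
    obtain ⟨qb, hqb, Hb⟩ := key i (n + 1) T L0
    obtain ⟨qc, hqc, Hc⟩ := key i n ((pd (eS 0)).comp T) (L1 0)
    obtain ⟨qd, hqd, Hd⟩ := key i n ((pd (eS 1)).comp T) (L1 1)
    refine ⟨_, q_add _ _ (q_add _ _ hqa hqb) (q_add _ _ hqc hqd), fun ψ x => ?_⟩
    have ca : ContDiff ℝ m (fun x => f χ G (i + 1) n T ψ x • L0) :=
      (f_contDiff hχ hG m _ _ _ ψ).smul contDiff_const
    have cb : ContDiff ℝ m (fun x => f χ G i (n + 1) T ψ x • L0) :=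
      (f_contDiff hχ hG m _ _ _ ψ).smul contDiff_const
    have cc : ContDiff ℝ m (fun x => f χ G i n ((pd (eS 0)).comp T) ψ x • L1 0) :=
      (f_contDiff hχ hG m _ _ _ ψ).smul contDiff_const
    have cd : ContDiff ℝ m (fun x => f χ G i n ((pd (eS 1)).comp T) ψ x • L1 1) :=
      (f_contDiff hχ hG m _ _ _ ψ).smul contDiff_const
    have e : fderiv ℝ (f χ G i n T ψ) =
        ((fun x => f χ G (i + 1) n T ψ x • L0) + (fun x => f χ G i (n + 1) T ψ x • L0)) +
        ((fun x => f χ G i n ((pd (eS 0)).comp T) ψ x • L1 0) +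
          (fun x => f χ G i n ((pd (eS 1)).comp T) ψ x • L1 1)) :=
      funext fun x => (f_fderiv hχ hG i n T ψ x).fderiv
    rw [← norm_iteratedFDeriv_fderiv, e, iteratedFDeriv_add (f := _ + _) (g := _ + _) (ca.add cb) (cc.add cd),
      iteratedFDeriv_add ca cb, iteratedFDeriv_add cc cd]
    simp only [Pi.add_apply]
    refine (mul_le_mul_of_nonneg_left ((norm_add_le _ _).trans
      (add_le_add (norm_add_le _ _) (norm_add_le _ _))) (by positivity)).trans ?_
    rw [mul_add, mul_add, mul_add]
    exact add_le_add (add_le_add (Ha ψ x) (Hb ψ x)) (add_le_add (Hc ψ x) (Hd ψ x))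

lemma main : ∃ E : S →L[ℂ] S, ∀ ψ : S, (∀ (w : ℝ) (σ : V), ψ (-w, σ) = ψ (w, σ)) →
    ∀ w : ℝ, 0 ≤ w → ∀ σ : V, E ψ (w, σ) = (w : ℂ) * ψ (√w, σ) := by
  obtain ⟨χ, hχs, hχ1, hχ0, hχb⟩ := exists_chi
  obtain ⟨G, hGs, hcos, hGb⟩ := exists_G
  have hχ : Good χ := ⟨hχs, hχb⟩
  have hG : Good G := ⟨hGs, hGb⟩
  refine ⟨SchwartzMap.mkCLM (fun ψ x => f χ G 0 0 M ψ x) ?_ ?_ ?_ ?_, ?_⟩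
  · intro ψ φ x
    simp only [f]
    rw [map_add, F_add hG, mul_add]
  · intro c ψ x
    simp only [f]
    rw [map_smul, F_smul, RingHom.id_apply, smul_eq_mul]
    ring
  · intro ψ
    exact contDiff_infty.2 fun m => f_contDiff hχ hG m 0 0 M ψ
  · rintro ⟨k, m⟩
    obtain ⟨q, hq, h⟩ := f_bound hχ hχ0 hG hcos k m 0 0 M
    obtain ⟨s, C, _, hC⟩ := Seminorm.bound_of_continuous (schwartz_withSeminorms ℂ X ℂ) q hq
    exact ⟨s, C, C.2, fun ψ x => (h ψ x).trans (hC ψ)⟩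
  · intro ψ hψ w hw σ
    change f χ G 0 0 M ψ (w, σ) = _
    have : (√w : ℂ) * √w = w := by
      rw [← Complex.ofReal_mul, Real.mul_self_sqrt hw]
    rw [f, iteratedDeriv_zero, hχ1 w hw]
    change _ * I (iteratedDeriv 0 G) (M ψ) (w, σ) = _
    rw [iteratedDeriv_zero, I_eval hcos _ _ hw, M_apply, M_apply, hψ]
    push_cast
    rw [neg_mul_neg, this]
    ring

end

end Helpers

end Ext12

theorem stmt12 :
    ∃ E₂ : SchwartzMap (ℝ × EuclideanSpace ℝ (Fin 2)) ℂ →L[ℂ]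
        SchwartzMap (ℝ × EuclideanSpace ℝ (Fin 2)) ℂ,
      ∀ ψ : SchwartzMap (ℝ × EuclideanSpace ℝ (Fin 2)) ℂ,
        (∀ (ω : ℝ) (σ : EuclideanSpace ℝ (Fin 2)), ψ (-ω, σ) = ψ (ω, σ)) →
        ∀ (ω : ℝ), 0 ≤ ω → ∀ σ : EuclideanSpace ℝ (Fin 2),
          E₂ ψ (ω, σ) = (ω : ℂ) * ψ (Real.sqrt ω, σ) := by
  exact Ext12.main
end
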